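/- Let k ≥ 0 and let M be a connected topological r-manifold. Suppose the elementary abelian group G = (ℤ/2)^k acts faithfully on M by homeomorphisms and the fixed point set of G on M is nonempty. Then k ≤ r. -/

import Mathlib

/-- The group of self-homeomorphisms of a topological space, with composition
as multiplication: `(f * g) x = f (g x)`. -/
instance homeoGroup (X : Type*) [TopologicalSpace X] : Group (X ≃ₜ X) where
  one := Homeomorph.refl X
  mul f g := g.trans f
  inv := Homeomorph.symm
  mul_assoc f g h := rfl
  one_mul f := Homeomorph.ext fun _ => rfl
  mul_one f := Homeomorph.ext fun _ => rfl
  inv_mul_cancel f := Homeomorph.ext fun x => f.symm_apply_apply x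

lemma homeo_one_apply {X : Type*} [TopologicalSpace X] (x : X) :
    (1 : X ≃ₜ X) x = x := rfl

namespace AlexanderSpanier
open Filter Topology

section Cochains
variable {E F : Type*}

/-- The Alexander–Spanier coboundary with coefficients in `ZMod 2`, on functions of finite
sequences of points; the empty sequence accounts for the augmentation. -/
def cobd (φ : List E → ZMod 2) : List E → ZMod 2
  | [] => 0
  | x :: l => φ l + cobd (fun m => φ (x :: m)) l

@[simp] lemma cobd_nil (φ : List E → ZMod 2) : cobd φ [] = 0 := by simp [cobd]

lemma cobd_cons (φ : List E → ZMod 2) (x : E) (l : List E) :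
    cobd φ (x :: l) = φ l + cobd (fun m => φ (x :: m)) l := by rw [cobd]

lemma cobd_add (φ ψ : List E → ZMod 2) (l : List E) :
    cobd (φ + ψ) l = cobd φ l + cobd ψ l := by
  induction l generalizing φ ψ with
  | nil => simp
  | cons x l ih =>
    have : (fun m => (φ + ψ) (x :: m)) = (fun m => φ (x :: m)) + fun m => ψ (x :: m) := rfl
    rw [cobd_cons, this, ih, cobd_cons, cobd_cons, Pi.add_apply]
    ring

lemma cobd_smul (c : ZMod 2) (φ : List E → ZMod 2) (l : List E) :
    cobd (c • φ) l = c * cobd φ l := by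
  induction l generalizing φ with
  | nil => simp
  | cons x l ih =>
    have : (fun m => (c • φ) (x :: m)) = c • (fun m => φ (x :: m)) := rfl
    rw [cobd_cons, this, ih, cobd_cons, Pi.smul_apply, smul_eq_mul]
    ring

/-- The coboundary as a linear map. -/
def cobdₗ : (List E → ZMod 2) →ₗ[ZMod 2] (List E → ZMod 2) where
  toFun := cobd
  map_add' φ ψ := funext (cobd_add φ ψ)
  map_smul' c φ := funext (cobd_smul c φ)

lemma cobd_cobd (φ : List E → ZMod 2) (l : List E) : cobd (cobd φ) l = 0 := by
  induction l generalizing φ with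
  | nil => simp
  | cons x l ih =>
    have : (fun m => cobd φ (x :: m)) = φ + cobd fun m => φ (x :: m) :=
      funext fun m => cobd_cons φ x m
    rw [cobd_cons, this, cobd_add, ih, add_zero, CharTwo.add_self_eq_zero]

/-- The value of `cobd φ` at `l` only depends on `φ` at strictly shorter sublists of `l`. -/
lemma cobd_eq_zero_of_sublist {φ : List E → ZMod 2} {l : List E}
    (h : ∀ m, m.Sublist l → m.length < l.length → φ m = 0) : cobd φ l = 0 := by
  induction l generalizing φ with
  | nil => simp
  | cons x l ih =>
    rw [cobd_cons, h l (List.sublist_cons_self x l) (by simp), zero_add]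
    exact ih fun m hm hl => h _ (hm.cons_cons x) (by simpa using hl)

lemma cobd_map (f : E → F) (φ : List F → ZMod 2) (l : List E) :
    cobd (fun m => φ (m.map f)) l = cobd φ (l.map f) := by
  induction l generalizing φ with
  | nil => simp
  | cons x l ih =>
    rw [List.map_cons, cobd_cons, cobd_cons, ← ih]
    rfl

lemma cobd_replicate (φ : List E → ZMod 2) (c : E) (n : ℕ) :
    cobd φ (List.replicate (n + 1) c) = (n + 1 : ℕ) * φ (List.replicate n c) := by
  induction n generalizing φ with
  | zero => simp [List.replicate, cobd_cons]
  | succ n ih =>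
    rw [List.replicate_succ, cobd_cons, ih, List.replicate_succ]
    push_cast
    ring

lemma cobd_comp_length (q : ℕ → ZMod 2) (l : List E) :
    cobd (fun m => q m.length) l = l.length * q (l.length - 1) := by
  induction l generalizing q with
  | nil => simp
  | cons x l ih =>
    rw [cobd_cons]
    have := ih fun n => q (n + 1)
    simp only [List.length_cons] at this ⊢
    rw [this]
    rcases l with _ | ⟨y, l⟩
    · simp
    · simp; ring

/-- Multiplication of a cochain by a function of the first point. -/
def cup (u : E → ZMod 2) (φ : List E → ZMod 2) : List E → ZMod 2
  | [] => 0
  | x :: l => u x * φ (x :: l)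

@[simp] lemma cup_nil (u : E → ZMod 2) (φ : List E → ZMod 2) : cup u φ [] = 0 := rfl

lemma cup_cons (u : E → ZMod 2) (φ : List E → ZMod 2) (x : E) (l : List E) :
    cup u φ (x :: l) = u x * φ (x :: l) := rfl

lemma cup_eq_zero {u : E → ZMod 2} {φ : List E → ZMod 2} {l : List E} (h : φ l = 0) :
    cup u φ l = 0 := by
  cases l <;> simp [cup, h]

lemma cobd_cup (u : E → ZMod 2) (φ : List E → ZMod 2) (x : E) (l : List E) :
    cobd (cup u φ) (x :: l) = u x * cobd φ (x :: l) + (cup u φ l + u x * φ l) := by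
  have : (fun m => cup u φ (x :: m)) = u x • fun m => φ (x :: m) := rfl
  rw [cobd_cons, this, cobd_smul, cobd_cons]
  have := CharTwo.add_self_eq_zero (u x * φ l)
  linear_combination -this

/-- The prism operator of a self-map. -/
def prism (G : E → E) (φ : List E → ZMod 2) : List E → ZMod 2
  | [] => 0
  | x :: l => φ (x :: G x :: l.map G) + prism G (fun m => φ (x :: m)) l

lemma prism_cons (G : E → E) (φ : List E → ZMod 2) (x : E) (l : List E) :
    prism G φ (x :: l) = φ (x :: G x :: l.map G) + prism G (fun m => φ (x :: m)) l := by
  rw [prism]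

lemma prism_add (G : E → E) (φ ψ : List E → ZMod 2) (l : List E) :
    prism G (φ + ψ) l = prism G φ l + prism G ψ l := by
  induction l generalizing φ ψ with
  | nil => simp [prism]
  | cons x l ih =>
    have : (fun m => (φ + ψ) (x :: m)) = (fun m => φ (x :: m)) + fun m => ψ (x :: m) := rfl
    rw [prism_cons, this, ih, prism_cons, prism_cons, Pi.add_apply]
    ring

lemma cobd_prism (G : E → E) (φ : List E → ZMod 2) (l : List E) :
    cobd (prism G φ) l = prism G (cobd φ) l + φ l + φ (l.map G) := by
  induction l generalizing φ with
  | nil => simp [prism, CharTwo.add_self_eq_zero]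
  | cons x l ih =>
    have h1 : (fun m => prism G φ (x :: m)) =
        (fun m => φ (x :: G x :: m.map G)) + prism G fun m => φ (x :: m) :=
      funext fun m => prism_cons G φ x m
    have h2 : (fun m => cobd φ (x :: m)) = φ + cobd fun m => φ (x :: m) :=
      funext fun m => cobd_cons φ x m
    have h3 := cobd_map G (fun m => φ (x :: G x :: m)) l
    rw [cobd_cons, h1, cobd_add, h3, ih, prism_cons, h2, prism_add, cobd_cons, cobd_cons,
      List.map_cons]
    have e1 := CharTwo.add_self_eq_zero (φ (G x :: l.map G))
    linear_combination -e1

lemma prism_eq_zero {G : E → E} {φ : List E → ZMod 2} {l : List E}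
    (h : ∀ m : List E, m.length ≤ l.length + 1 → (∀ x ∈ m, x ∈ l ∨ ∃ y ∈ l, x = G y) → φ m = 0) :
    prism G φ l = 0 := by
  induction l generalizing φ with
  | nil => simp [prism]
  | cons x l ih =>
    rw [prism_cons, h _ (by simp) (by simp; grind), zero_add]
    refine ih fun m hm hx => h _ (by simpa using hm) fun y hy => ?_
    rcases List.mem_cons.1 hy with rfl | hy
    · simp
    · rcases hx y hy with h | ⟨z, hz, rfl⟩
      · simp [h]
      · exact .inr ⟨z, by simp [hz], rfl⟩

lemma prism_replicate {G : E → E} {c : E} (hc : G c = c) (φ : List E → ZMod 2) (n : ℕ) :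
    prism G φ (List.replicate n c) = n * φ (List.replicate (n + 1) c) := by
  induction n generalizing φ with
  | zero => simp [prism]
  | succ n ih =>
    rw [List.replicate_succ, prism_cons, ih, List.map_replicate, hc]
    simp only [List.replicate_succ]
    push_cast
    ring

end Cochains

section NearDiag
variable {E F : Type*} [TopologicalSpace E] [TopologicalSpace F]

/-- Sequences of at most `n` points which are all close to `p`. -/
def nearDiag (n : ℕ) (p : E) : Filter (List E) :=
  (𝓝 p).lift' fun U => {l | l.length ≤ n ∧ ∀ x ∈ l, x ∈ U}

lemma eventually_nearDiag {n : ℕ} {p : E} {P : List E → Prop} :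
    (∀ᶠ l in nearDiag n p, P l) ↔
      ∃ U ∈ 𝓝 p, ∀ l : List E, l.length ≤ n → (∀ x ∈ l, x ∈ U) → P l := by
  rw [nearDiag, Filter.eventually_lift'_iff]
  · simp
  · exact fun U V hUV l hl => ⟨hl.1, fun x hx => hUV (hl.2 x hx)⟩

lemma eventually_length (n : ℕ) (p : E) : ∀ᶠ l in nearDiag n p, l.length ≤ n :=
  eventually_nearDiag.2 ⟨_, univ_mem, fun _ h _ => h⟩

lemma eventually_forall_mem {p : E} {P : E → Prop} (h : ∀ᶠ x in 𝓝 p, P x) (n : ℕ) :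
    ∀ᶠ l in nearDiag n p, ∀ x ∈ l, P x :=
  eventually_nearDiag.2 ⟨_, h, fun _ _ h => h⟩

lemma nearDiag_mono {m n : ℕ} (h : m ≤ n) (p : E) : nearDiag m p ≤ nearDiag n p := by
  intro s hs
  obtain ⟨U, hU, H⟩ := eventually_nearDiag.1 hs
  exact eventually_nearDiag.2 ⟨U, hU, fun l hl => H l (hl.trans h)⟩

lemma pure_nil_le_nearDiag (n : ℕ) (p : E) : pure [] ≤ nearDiag n p := by
  intro s hs
  obtain ⟨U, hU, H⟩ := eventually_nearDiag.1 hs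
  exact H [] (by simp) (by simp)

lemma eventually_cobd_eq_zero {n : ℕ} {p : E} {φ : List E → ZMod 2}
    (h : ∀ᶠ l in nearDiag n p, φ l = 0) : ∀ᶠ l in nearDiag (n + 1) p, cobd φ l = 0 := by
  obtain ⟨U, hU, H⟩ := eventually_nearDiag.1 h
  refine eventually_nearDiag.2 ⟨U, hU, fun l hl hx => cobd_eq_zero_of_sublist fun m hm hlt => ?_⟩
  exact H m (by omega) fun x hxm => hx x (hm.subset hxm)

lemma tendsto_map_nearDiag {f : E → F} {p : E} (hf : ContinuousAt f p) (n : ℕ) :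
    Tendsto (List.map f) (nearDiag n p) (nearDiag n (f p)) := by
  intro s hs
  obtain ⟨U, hU, H⟩ := eventually_nearDiag.1 hs
  refine eventually_nearDiag.2 ⟨f ⁻¹' U, hf hU, fun l hl hx => H _ (by simpa using hl) ?_⟩
  simpa using hx

end NearDiag

section StarConvex

/-- A locally vanishing cochain vanishes on sequences whose size is controlled by a
Lipschitz function of the position. -/
lemma exists_lipschitz_radius {E : Type*} [PseudoMetricSpace E] {X : Set E}
    {φ : List E → ZMod 2} {n : ℕ} (h0 : φ [] = 0)
    (h : ∀ p ∈ X, ∀ᶠ l in nearDiag n p, φ l = 0) :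
    ∃ ρ : E → ℝ, LipschitzWith 1 ρ ∧ (∀ p ∈ X, 0 < ρ p) ∧
      ∀ p, ∀ l : List E, l.length ≤ n → (∀ x ∈ l, dist x p < ρ p) → φ l = 0 := by
  let S : E → Set ℝ := fun p => {t | 0 ≤ t ∧ t ≤ 1 ∧
    ∀ l : List E, l.length ≤ n → (∀ x ∈ l, dist x p < t) → φ l = 0}
  have hS0 : ∀ p, (0 : ℝ) ∈ S p := fun p => ⟨le_rfl, zero_le_one, fun l _ hx => by
    rcases l with _ | ⟨x, l⟩
    · exact h0
    · exact absurd (hx x (by simp)) (not_lt.2 dist_nonneg)⟩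
  have hbdd : ∀ p, BddAbove (S p) := fun p => ⟨1, fun t ht => ht.2.1⟩
  have hnn : ∀ p, 0 ≤ sSup (S p) := fun p => le_csSup (hbdd p) (hS0 p)
  have hle : ∀ p q, sSup (S p) ≤ sSup (S q) + dist p q := fun p q => by
    refine csSup_le ⟨0, hS0 p⟩ fun t ht => ?_
    by_cases hd : t ≤ dist p q
    · linarith [hnn q]
    · have : t - dist p q ∈ S q := by
        refine ⟨by linarith, by linarith [ht.2.1, dist_nonneg (x := p) (y := q)],
          fun l hl hx => ht.2.2 l hl fun x hxl => ?_⟩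
        have := hx x hxl
        have := dist_triangle x q p
        rw [dist_comm q p] at this
        linarith
      linarith [le_csSup (hbdd q) this]
  refine ⟨fun p => sSup (S p) / 2, LipschitzWith.of_le_add fun p q => ?_, fun p hp => ?_,
    fun p l hl hx => ?_⟩
  · have := hle p q
    have := dist_nonneg (x := p) (y := q)
    linarith
  · obtain ⟨U, hU, H⟩ := eventually_nearDiag.1 (h p hp)
    obtain ⟨ε, hε, hb⟩ := Metric.mem_nhds_iff.1 hU
    have : min ε 1 ∈ S p := ⟨by positivity, min_le_right _ _, fun l hl hx =>
      H l hl fun x hxl => hb (Metric.mem_ball.2 ((hx x hxl).trans_le (min_le_left _ _)))⟩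
    have h1 := le_csSup (hbdd p) this
    have h2 : 0 < min ε 1 := by positivity
    show 0 < sSup (S p) / 2
    linarith
  · rcases (hnn p).eq_or_lt with h | h
    · refine (hS0 p).2.2 l hl fun x hxl => ?_
      have := hx x hxl
      simpa [← h] using this
    · obtain ⟨t, ht, hlt⟩ := exists_lt_of_lt_csSup ⟨0, hS0 p⟩ (half_lt_self h)
      exact ht.2.2 l hl fun x hxl => (hx x hxl).trans hlt

variable {E : Type*} [NormedAddCommGroup E] [NormedSpace ℝ E]

/-- Move every point `x` towards `c` by the distance `ρ x`. -/
noncomputable def pull (ρ : E → ℝ) (c x : E) : E :=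
  c + max 0 (1 - ρ x / ‖x - c‖) • (x - c)

lemma pull_self (ρ : E → ℝ) (c : E) : pull ρ c c = c := by simp [pull]

lemma pull_eq_center {ρ : E → ℝ} {c x : E} (h : ‖x - c‖ ≤ ρ x) : pull ρ c x = c := by
  rcases eq_or_ne x c with rfl | hx
  · exact pull_self ρ x
  · have : 0 < ‖x - c‖ := norm_pos_iff.2 (sub_ne_zero.2 hx)
    have : 1 ≤ ρ x / ‖x - c‖ := by rwa [one_le_div this]
    rw [pull, max_eq_left (by linarith), zero_smul, add_zero]

lemma pull_mem_segment {ρ : E → ℝ} {c x : E} (h : 0 ≤ ρ x) : pull ρ c x ∈ segment ℝ c x := by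
  rw [segment_eq_image']
  refine ⟨max 0 (1 - ρ x / ‖x - c‖), ⟨le_max_left _ _, max_le zero_le_one ?_⟩, rfl⟩
  have : 0 ≤ ρ x / ‖x - c‖ := by positivity
  linarith

lemma norm_pull_sub {ρ : E → ℝ} {c x : E} (h : 0 ≤ ρ x) :
    ‖pull ρ c x - c‖ = max 0 (‖x - c‖ - ρ x) := by
  rcases eq_or_ne x c with rfl | hx
  · simp [pull_self, h]
  · have : 0 < ‖x - c‖ := norm_pos_iff.2 (sub_ne_zero.2 hx)
    rw [pull, add_sub_cancel_left, norm_smul, Real.norm_of_nonneg (le_max_left _ _),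
      max_mul_of_nonneg _ _ this.le, zero_mul, sub_mul, div_mul_cancel₀ _ this.ne', one_mul]

lemma dist_pull_le {ρ : E → ℝ} {c x : E} (h : 0 ≤ ρ x) : dist (pull ρ c x) x ≤ ρ x := by
  rcases le_total ‖x - c‖ (ρ x) with h' | h'
  · rwa [pull_eq_center h', dist_comm, dist_eq_norm]
  · rcases eq_or_ne x c with rfl | hx
    · simpa [pull_self] using h
    · have h0 : 0 < ‖x - c‖ := norm_pos_iff.2 (sub_ne_zero.2 hx)
      have : ρ x / ‖x - c‖ ≤ 1 := by rwa [div_le_one h0]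
      have e : pull ρ c x - x = -(ρ x / ‖x - c‖) • (x - c) := by
        rw [pull, max_eq_right (by linarith)]
        module
      rw [dist_eq_norm, e, norm_smul, norm_neg, Real.norm_of_nonneg (by positivity),
        div_mul_cancel₀ _ h0.ne']

lemma continuousAt_pull {ρ : E → ℝ} {c x : E} (hρ : Continuous ρ) (hx : 0 < ρ x) :
    ContinuousAt (pull ρ c) x := by
  rcases eq_or_ne x c with rfl | h
  · have : ∀ᶠ y in 𝓝 x, ‖y - x‖ < ρ y := by
      have h1 : Continuous fun y => ρ y - ‖y - x‖ := by fun_prop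
      have := h1.continuousAt.eventually (lt_mem_nhds (a := 0) (b := ρ x - ‖x - x‖) (by simpa))
      filter_upwards [this] with y hy
      linarith
    have : pull ρ x =ᶠ[𝓝 x] fun _ => x := by
      filter_upwards [this] with y hy
      exact pull_eq_center hy.le
    exact continuousAt_const.congr this.symm
  · have : ‖x - c‖ ≠ 0 := norm_ne_zero_iff.2 (sub_ne_zero.2 h)
    have := hρ.continuousAt (x := x)
    unfold pull
    fun_prop (disch := assumption)

lemma norm_iterate_pull_sub {ρ : E → ℝ} {c x : E} {m : ℝ} (hm : 0 ≤ m)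
    (h : ∀ y ∈ segment ℝ c x, m ≤ ρ y) (n : ℕ) :
    (pull ρ c)^[n] x ∈ segment ℝ c x ∧ ‖(pull ρ c)^[n] x - c‖ ≤ max 0 (‖x - c‖ - n * m) := by
  induction n with
  | zero => simp [right_mem_segment]
  | succ n ih =>
    have hy := h _ ih.1
    rw [Function.iterate_succ_apply', norm_pull_sub (hm.trans hy)]
    refine ⟨?_, ?_⟩
    · exact (convex_segment c x).segment_subset (left_mem_segment ℝ c x) ih.1
        (pull_mem_segment (hm.trans hy))
    · push_cast
      rcases le_max_iff.1 ih.2 with h1 | h1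
      · exact (max_le le_rfl (by linarith)).trans (le_max_left _ _)
      · exact max_le_max le_rfl (by linarith)

lemma exists_iterate_pull_eq {ρ : E → ℝ} {c p : E} (hρ : LipschitzWith 1 ρ)
    (h : ∀ y ∈ segment ℝ c p, 0 < ρ y) :
    ∃ n, ∀ᶠ x in 𝓝 p, ∀ s ≥ n, (pull ρ c)^[s] x = c := by
  have hcpt : IsCompact (segment ℝ c p) := by
    rw [segment_eq_image']
    exact isCompact_Icc.image (by fun_prop)
  obtain ⟨y, hy, hmin⟩ := hcpt.exists_isMinOn ⟨c, left_mem_segment ℝ c p⟩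
    hρ.continuous.continuousOn
  set m := ρ y / 2 with hmdef
  have hm : 0 < m := half_pos (h y hy)
  obtain ⟨n, hn⟩ := exists_nat_gt ((‖p - c‖ + m) / m)
  rw [div_lt_iff₀ hm] at hn
  refine ⟨n, ?_⟩
  filter_upwards [Metric.ball_mem_nhds p hm] with x hx s hs
  have hxp : dist x p < m := hx
  have key : ∀ z ∈ segment ℝ c x, m ≤ ρ z := by
    intro z hz
    rw [segment_eq_image'] at hz
    obtain ⟨t, ht, rfl⟩ := hz
    have h1 : ρ y ≤ ρ (c + t • (p - c)) := hmin (by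
      rw [segment_eq_image']; exact ⟨t, ht, rfl⟩)
    have h2 := hρ.dist_le_mul (c + t • (p - c)) (c + t • (x - c))
    have h3 : dist (c + t • (p - c)) (c + t • (x - c)) ≤ dist x p := by
      rw [dist_add_left, dist_eq_norm, ← smul_sub, norm_smul, Real.norm_of_nonneg ht.1,
        sub_sub_sub_cancel_right, ← dist_eq_norm, dist_comm p x]
      exact mul_le_of_le_one_left dist_nonneg ht.2
    rw [Real.dist_eq, NNReal.coe_one, one_mul] at h2
    have := le_abs_self (ρ (c + t • (p - c)) - ρ (c + t • (x - c)))
    simp only at *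
    linarith
  have h4 := (norm_iterate_pull_sub hm.le key s).2
  have h5 : ‖x - c‖ ≤ ‖p - c‖ + m := by
    have := dist_triangle x p c
    rw [← dist_eq_norm, ← dist_eq_norm]
    linarith
  have h6 : (n : ℝ) * m ≤ s * m := by gcongr
  rw [max_eq_left (by linarith)] at h4
  exact sub_eq_zero.1 (norm_le_zero_iff.1 h4)

end StarConvex

section Acyclic
variable {E : Type*} [NormedAddCommGroup E] [NormedSpace ℝ E]

/-- Alexander–Spanier cocycles on star-convex sets are coboundaries. -/
lemma exists_eq_cobd_of_starConvex {X : Set E} {c : E} (hX : StarConvex ℝ c X) (hc : c ∈ X)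
    {N : ℕ} {φ : List E → ZMod 2}
    (h : ∀ p ∈ X, ∀ᶠ l in nearDiag (N + 2) p, cobd φ l = 0) :
    ∃ ψ : List E → ZMod 2, ∀ p ∈ X, ∀ᶠ l in nearDiag N p, φ l = cobd ψ l := by
  obtain ⟨ρ, hρ, hpos, hvan⟩ := exists_lipschitz_radius (cobd_nil φ) h
  set σ : E → ℝ := fun x => ρ x / 2 with hσdef
  have hσ : LipschitzWith 1 σ := LipschitzWith.of_le_add fun p q => by
    have h1 := hρ.dist_le_mul p q
    rw [Real.dist_eq, NNReal.coe_one, one_mul] at h1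
    have := le_abs_self (ρ p - ρ q)
    have := dist_nonneg (x := p) (y := q)
    simp only [hσdef]
    linarith
  have hσpos : ∀ p ∈ X, 0 < σ p := fun p hp => half_pos (hpos p hp)
  set G := pull σ c with hG
  have hGc : G c = c := pull_self σ c
  have hrep : ∀ n ≤ N + 1, ((n + 1 : ℕ) : ZMod 2) * φ (List.replicate n c) = 0 := by
    intro n hn
    rw [← cobd_replicate]
    refine hvan c _ (by simpa using hn) fun x hx => ?_
    rw [List.eq_of_mem_replicate hx, dist_self]
    exact hpos c hc
  have hGX : ∀ p ∈ X, G p ∈ X := fun p hp =>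
    hX.segment_subset hp (pull_mem_segment (hσpos p hp).le)
  have hit : ∀ (s : ℕ), ∀ p ∈ X, G^[s] p ∈ X ∧ ContinuousAt G^[s] p := by
    intro s
    induction s with
    | zero => exact fun p hp => ⟨hp, continuousAt_id⟩
    | succ s ih =>
      intro p hp
      rw [Function.iterate_succ']
      exact ⟨hGX _ (ih p hp).1, ContinuousAt.comp
        (continuousAt_pull hσ.continuous (hσpos _ (ih p hp).1)) (ih p hp).2⟩
  have hprism : ∀ p ∈ X, ∀ᶠ l in nearDiag (N + 1) p, prism G (cobd φ) l = 0 := by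
    intro p hp
    refine eventually_nearDiag.2 ⟨_, Metric.ball_mem_nhds p (half_pos (half_pos (hσpos p hp))),
      fun l hl hx => prism_eq_zero fun m hm hmx => hvan p m (by omega) fun x hxm => ?_⟩
    have key : ∀ y ∈ l, dist y p < σ p / 2 / 2 := fun y hy => hx y hy
    have h0 := hσpos p hp
    have hρσ : ρ p = 2 * σ p := by simp [hσdef]; ring
    rcases hmx x hxm with hxl | ⟨y, hy, rfl⟩
    · linarith [key x hxl]
    · have h1 := hσ.dist_le_mul y p
      rw [Real.dist_eq, NNReal.coe_one, one_mul, abs_le] at h1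
      have h2 := key y hy
      have h3 : dist (G y) y ≤ σ y := dist_pull_le (by linarith [h1.1])
      have := dist_triangle (G y) y p
      linarith [h1.2]
  have hstep : ∀ p ∈ X, ∀ s, ∀ᶠ l in nearDiag (N + 1) p,
      cobd (fun m => prism G φ (m.map G^[s])) l = φ (l.map G^[s]) + φ (l.map G^[s + 1]) := by
    intro p hp s
    filter_upwards [(tendsto_map_nearDiag (hit s p hp).2 (N + 1)).eventually
      (hprism _ (hit s p hp).1)] with l hl
    rw [cobd_map, cobd_prism, hl, zero_add, Function.iterate_succ', List.map_map]
  have hsum : ∀ p ∈ X, ∀ n, ∀ᶠ l in nearDiag (N + 1) p,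
      cobd (∑ s ∈ Finset.range n, fun m => prism G φ (m.map G^[s])) l =
        φ l + φ (l.map G^[n]) := by
    intro p hp n
    induction n with
    | zero =>
      refine .of_forall fun l => ?_
      rw [Finset.range_zero, Finset.sum_empty, Function.iterate_zero, List.map_id,
        CharTwo.add_self_eq_zero]
      exact congrFun (map_zero cobdₗ) l
    | succ n ih =>
      filter_upwards [ih, hstep p hp n] with l h1 h2
      rw [Finset.sum_range_succ, cobd_add, h1, h2]
      have := CharTwo.add_self_eq_zero (φ (l.map G^[n]))
      linear_combination this
  refine ⟨(fun l => ∑ᶠ s, prism G φ (l.map G^[s])) +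
    fun l => φ (List.replicate (l.length + 1) c), fun p hp => ?_⟩
  obtain ⟨n, hn⟩ := exists_iterate_pull_eq (ρ := σ) (c := c) (p := p) hσ
    fun y hy => hσpos y (hX.segment_subset hp hy)
  have hconst : ∀ᶠ l in nearDiag N p, ∀ s ≥ n,
      l.map G^[s] = List.replicate l.length c := by
    filter_upwards [eventually_forall_mem hn N] with l hl s hs
    refine List.eq_replicate_iff.2 ⟨by simp, fun y hy => ?_⟩
    obtain ⟨x, hx, rfl⟩ := List.mem_map.1 hy
    exact hl x hx s hs
  have hfin : ∀ᶠ l in nearDiag N p, ((fun l => ∑ᶠ s, prism G φ (l.map G^[s])) +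
      ∑ s ∈ Finset.range n, fun m => prism G φ (m.map G^[s]) : List E → ZMod 2) l = 0 := by
    filter_upwards [hconst, eventually_length N p] with l hl hlen
    rw [Pi.add_apply, Finset.sum_apply, finsum_eq_sum_of_support_subset _
      (s := Finset.range n), CharTwo.add_self_eq_zero]
    intro s hs
    by_contra hns
    refine hs ?_
    beta_reduce
    rw [hl s (by simpa using hns), prism_replicate hGc]
    have := hrep (l.length + 1) (by omega)
    push_cast at this ⊢
    linear_combination this - CharTwo.two_eq_zero (R := ZMod 2) *
      φ (List.replicate (l.length + 1) c)
  filter_upwards [nearDiag_mono (Nat.le_succ N) p (eventually_cobd_eq_zero hfin),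
    nearDiag_mono (Nat.le_succ N) p (hsum p hp n), hconst, eventually_length N p]
    with l h1 h2 h3 h4
  rw [cobd_add, h2, h3 n le_rfl] at h1
  rw [cobd_add, cobd_comp_length fun n => φ (List.replicate (n + 1) c)]
  have h5 := hrep l.length (by omega)
  have h6 : (l.length : ZMod 2) * φ (List.replicate (l.length - 1 + 1) c) =
      l.length * φ (List.replicate l.length c) := by
    rcases l with _ | ⟨x, l⟩ <;> simp
  rw [h6]
  push_cast at h5
  have h7 := CharTwo.two_eq_zero (R := ZMod 2)
  linear_combination -h1 - h5 + (φ l + φ (List.replicate l.length c)) * h7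

end Acyclic

section OffDiagonal

lemma tendsto_tail_nearDiag {E : Type*} [TopologicalSpace E] (n : ℕ) (p : E) :
    Tendsto List.tail (nearDiag n p) (nearDiag n p) := by
  intro s hs
  obtain ⟨U, hU, H⟩ := eventually_nearDiag.1 hs
  exact eventually_nearDiag.2 ⟨U, hU, fun l hl hx =>
    H _ ((by rw [List.length_tail]; omega)) fun x hxl => hx x (List.mem_of_mem_tail hxl)⟩

/-- The iterated connecting cochains attached to a sequence of `ZMod 2`-valued functions. -/
def theta {E : Type*} (h : ℕ → E → ZMod 2) : ℕ → List E → ZMod 2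
  | 0 => fun l => if l.isEmpty then 1 else 0
  | m + 1 => cup (h m) (cobd (theta h m))

lemma theta_succ {E : Type*} (h : ℕ → E → ZMod 2) (m : ℕ) :
    theta h (m + 1) = cup (h m) (cobd (theta h m)) := rfl

variable {r : ℕ}

/-- Pairs of points of `B` which differ in one of the first `m` coordinates. -/
def offDiag (B : Set (EuclideanSpace ℝ (Fin r))) (m : ℕ) :
    Set (EuclideanSpace ℝ (Fin r) × EuclideanSpace ℝ (Fin r)) :=
  {p | p.1 ∈ B ∧ p.2 ∈ B ∧ ∃ i : Fin r, (i : ℕ) < m ∧ p.1 i ≠ p.2 i}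

/-- The pairs in `offDiag B m`, and those which differ in the coordinate `j` in the direction
of the sign of `σ`. -/
def halfOffDiag (B : Set (EuclideanSpace ℝ (Fin r))) (m : ℕ) (j : Fin r) (σ : ℝ) :
    Set (EuclideanSpace ℝ (Fin r) × EuclideanSpace ℝ (Fin r)) :=
  {p | p.1 ∈ B ∧ p.2 ∈ B ∧
    ((∃ i : Fin r, (i : ℕ) < m ∧ p.1 i ≠ p.2 i) ∨ 0 < σ * (p.2 j - p.1 j))}

lemma exists_starConvex_halfOffDiag {B : Set (EuclideanSpace ℝ (Fin r))} (hB : IsOpen B)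
    (hBc : Convex ℝ B) (hne : B.Nonempty) {m : ℕ} {j : Fin r} (hj : m ≤ j) {σ : ℝ} (hσ : σ ≠ 0) :
    ∃ c ∈ halfOffDiag B m j σ, StarConvex ℝ c (halfOffDiag B m j σ) := by
  obtain ⟨b, hb⟩ := hne
  have hcont : Continuous fun η : ℝ => b + η • (EuclideanSpace.single j σ) := by fun_prop
  have hev : ∀ᶠ η in 𝓝[>] (0 : ℝ), b + η • (EuclideanSpace.single j σ) ∈ B := by
    refine nhdsWithin_le_nhds (hcont.continuousAt.eventually (hB.mem_nhds ?_))
    simpa using hb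
  obtain ⟨η, hηB, hη⟩ := (hev.and self_mem_nhdsWithin).exists
  have hη : 0 < η := hη
  have hsq : 0 < σ * σ := mul_self_pos.2 hσ
  refine ⟨(b, b + η • EuclideanSpace.single j σ), ⟨hb, hηB, .inr ?_⟩, ?_⟩
  · simp only [PiLp.add_apply, PiLp.smul_apply, smul_eq_mul, add_sub_cancel_left,
      PiLp.single_apply, if_true]
    nlinarith
  · intro p hp s t hs ht hst
    refine ⟨hBc hb hp.1 hs ht hst, hBc hηB hp.2.1 hs ht hst, ?_⟩
    simp only [Prod.fst_add, Prod.smul_fst, Prod.snd_add, Prod.smul_snd, PiLp.add_apply,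
      PiLp.smul_apply, smul_eq_mul, PiLp.single_apply, mul_ite, mul_zero]
    rcases ht.eq_or_lt with rfl | ht
    · right
      have : s = 1 := by linarith
      subst this
      simp
      nlinarith
    · rcases hp.2.2 with ⟨i, hi, hne⟩ | hpos
      · left
        refine ⟨i, hi, ?_⟩
        have hij : i ≠ j := fun h => by subst h; omega
        simp only [hij, if_false, add_zero]
        intro h
        exact hne (mul_left_cancel₀ ht.ne' (add_left_cancel h))
      · right
        have h1 : 0 < t * (σ * (p.2 j - p.1 j)) := mul_pos ht hpos
        have h2 : 0 ≤ s * (η * (σ * σ)) := by positivity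
        simp only [if_true]
        nlinarith

lemma isOpen_lt_coord (j : Fin r) :
    IsOpen {p : EuclideanSpace ℝ (Fin r) × EuclideanSpace ℝ (Fin r) | p.1 j < p.2 j} :=
  isOpen_lt (by fun_prop) (by fun_prop)

lemma isOpen_gt_coord (j : Fin r) :
    IsOpen {p : EuclideanSpace ℝ (Fin r) × EuclideanSpace ℝ (Fin r) | p.2 j < p.1 j} :=
  isOpen_lt (by fun_prop) (by fun_prop)

lemma cup_const {E : Type*} {u : E → ZMod 2} {η : ZMod 2} {z : List E → ZMod 2}
    (hz : z [] = 0) {l : List E} (hl : ∀ x ∈ l, u x = η) : cup u z l = η * z l := by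
  rcases l with _ | ⟨x, l⟩
  · simp [hz]
  · rw [cup_cons, hl x (by simp)]

/-- The reduced Alexander–Spanier cohomology of the complement of the diagonal in `B × B`
is spanned by the class of `theta`. -/
theorem exists_eq_theta_add_cobd {B : Set (EuclideanSpace ℝ (Fin r))} (hB : IsOpen B)
    (hBc : Convex ℝ B) (hne : B.Nonempty)
    {h : ℕ → EuclideanSpace ℝ (Fin r) × EuclideanSpace ℝ (Fin r) → ZMod 2}
    (h1 : ∀ (i : Fin r) p, p.1 ∈ B → p.2 ∈ B → p.1 i < p.2 i → h i p = 1)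
    (h0 : ∀ (i : Fin r) p, p.1 ∈ B → p.2 ∈ B → p.2 i < p.1 i → h i p = 0)
    {m : ℕ} (hm : m ≤ r) (N : ℕ)
    {φ : List (EuclideanSpace ℝ (Fin r) × EuclideanSpace ℝ (Fin r)) → ZMod 2}
    (hφ : ∀ p ∈ offDiag B m, ∀ᶠ l in nearDiag (N + 2 * m) p, cobd φ l = 0) :
    ∃ (ε : ZMod 2) (ψ : List (EuclideanSpace ℝ (Fin r) × EuclideanSpace ℝ (Fin r)) → ZMod 2),
      φ [] = ε * theta h m [] ∧
      ∀ p ∈ offDiag B m, ∀ᶠ l in nearDiag N p, φ l + ε * theta h m l + cobd ψ l = 0 := by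
  induction m generalizing φ with
  | zero =>
    refine ⟨φ [], 0, by simp [theta], fun p hp => ?_⟩
    obtain ⟨-, -, i, hi, -⟩ := hp
    omega
  | succ m ih =>
    let j : Fin r := ⟨m, hm⟩
    have hacyc : ∀ σ : ℝ, σ ≠ 0 →
        ∃ a : List (EuclideanSpace ℝ (Fin r) × EuclideanSpace ℝ (Fin r)) → ZMod 2,
        φ [] = 0 ∧
        ∀ p ∈ halfOffDiag B m j σ, ∀ᶠ l in nearDiag (N + 2 * m) p, φ l = cobd a l := by
      intro σ hσ
      obtain ⟨c, hc, hst⟩ := exists_starConvex_halfOffDiag hB hBc hne (m := m) (j := j) le_rfl hσ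
      have hsub : halfOffDiag B m j σ ⊆ offDiag B (m + 1) := by
        refine fun p hp => ⟨hp.1, hp.2.1, ?_⟩
        rcases hp.2.2 with ⟨i, hi, hip⟩ | hpos
        · exact ⟨i, by omega, hip⟩
        · exact ⟨j, Nat.lt_succ_self m, fun he => by simp [he] at hpos⟩
      obtain ⟨a, ha⟩ := exists_eq_cobd_of_starConvex (N := N + 2 * m) (φ := φ) hst hc
        fun p hp => hφ p (hsub hp)
      refine ⟨a, ?_, ha⟩
      simpa using (ha c hc).filter_mono (pure_nil_le_nearDiag _ _)
    obtain ⟨a, hnil, ha⟩ := hacyc 1 one_ne_zero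
    obtain ⟨b, -, hb⟩ := hacyc (-1) (by simp)
    have hsub : ∀ σ, ∀ p ∈ offDiag B m, p ∈ halfOffDiag B m j σ :=
      fun σ p hp => ⟨hp.1, hp.2.1, .inl hp.2.2⟩
    obtain ⟨ε, c, hcnil, hc⟩ := ih (by omega) (φ := a + b) fun p hp => by
      filter_upwards [ha p (hsub _ p hp), hb p (hsub _ p hp)] with l hl1 hl2
      rw [cobd_add, ← hl1, ← hl2, CharTwo.add_self_eq_zero]
    set z := a + b + ε • theta h m + cobd c with hz
    have hznil : z [] = 0 := by
      simp only [hz, Pi.add_apply, Pi.smul_apply, smul_eq_mul, cobd_nil, add_zero]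
      rw [← hcnil, Pi.add_apply, CharTwo.add_self_eq_zero]
    have hz0 : ∀ p ∈ offDiag B m, ∀ᶠ l in nearDiag N p, z l = 0 := hc
    have hcz : ∀ l, cobd z l = cobd a l + cobd b l + ε * cobd (theta h m) l := fun l => by
      rw [hz, cobd_add, cobd_add, cobd_add, cobd_smul, cobd_cobd, add_zero]
    have hlev : ∀ p : EuclideanSpace ℝ (Fin r) × EuclideanSpace ℝ (Fin r),
        nearDiag N p ≤ nearDiag (N + 2 * m) p := nearDiag_mono (by omega)
    refine ⟨ε, cup (h m) z + b, by simp [hnil, theta_succ], fun p hp => ?_⟩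
    have h2 := CharTwo.two_eq_zero (R := ZMod 2)
    have hconst : ∀ (η : ZMod 2) (a' : List _ → ZMod 2),
        (a' = fun l => η * cobd a l + (1 + η) * cobd b l) →
        (∀ᶠ l in nearDiag N p, φ l = a' l) → (∀ᶠ q in 𝓝 p, h m q = η) →
        ∀ᶠ l in nearDiag N p,
          φ l + ε * theta h (m + 1) l + cobd (cup (h m) z + b) l = 0 := by
      rintro η a' rfl hφa hη
      filter_upwards [hφa, eventually_forall_mem hη N] with l hl hx
      rcases l with _ | ⟨x, l⟩
      · simp [hnil, theta_succ]
      · rw [cobd_add, cobd_cup, theta_succ, cup_cons, hx x (by simp), hcz,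
          cup_const hznil fun y hy => hx y (by simp [hy]), hl]
        linear_combination (η * z l + η * cobd a (x :: l) + η * cobd b (x :: l)
          + cobd b (x :: l) + ε * η * cobd (theta h m) (x :: l)) * h2
    have hopen : ∀ᶠ q in 𝓝 p, q.1 ∈ B ∧ q.2 ∈ B :=
      (hB.prod hB).mem_nhds ⟨hp.1, hp.2.1⟩
    rcases lt_trichotomy (p.1 j) (p.2 j) with hlt | heq | hgt
    · refine hconst 1 _ rfl ?_ ?_
      · have := ha p ⟨hp.1, hp.2.1, .inr (by simpa using hlt)⟩
        filter_upwards [this.filter_mono (hlev p)] with l hl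
        linear_combination hl - cobd b l * h2
      · filter_upwards [hopen, (isOpen_lt_coord j).mem_nhds hlt] with q hq hlt
        exact h1 j q hq.1 hq.2 hlt
    · have hpm : p ∈ offDiag B m := by
        obtain ⟨hp1, hp2, i, hi, hne⟩ := hp
        refine ⟨hp1, hp2, i, lt_of_le_of_ne (Nat.lt_succ_iff.1 hi) fun him => hne ?_, hne⟩
        have : i = j := Fin.ext him
        rw [this, heq]
      filter_upwards [(ha p (hsub _ p hpm)).filter_mono (hlev p),
        (hb p (hsub _ p hpm)).filter_mono (hlev p), hz0 p hpm,
        (tendsto_tail_nearDiag N p).eventually (hz0 p hpm),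
        nearDiag_mono (Nat.le_succ N) p (eventually_cobd_eq_zero (hz0 p hpm))]
        with l hl1 hl2 hl3 hl4 hl5
      rcases l with _ | ⟨x, l⟩
      · simp [hnil, theta_succ]
      · have hl5 : cobd z (x :: l) = 0 := hl5
        have hl4 : z l = 0 := hl4
        rw [cobd_add, cobd_cup, theta_succ, cup_cons, hl5, cup_eq_zero hl4, hl4, hl2]
        rw [hcz, ← hl1, ← hl2] at hl5
        linear_combination h m x * hl5 + (cobd b (x :: l) - h m x * φ (x :: l)) * h2
    · refine hconst 0 _ rfl ?_ ?_
      · have := hb p ⟨hp.1, hp.2.1, .inr (by simpa using hgt)⟩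
        filter_upwards [this.filter_mono (hlev p)] with l hl
        linear_combination hl
      · filter_upwards [hopen, (isOpen_gt_coord j).mem_nhds hgt] with q hq hlt
        exact h0 j q hq.1 hq.2 hlt

lemma cobd_theta_eq_zero {E : Type*} {h : ℕ → E → ZMod 2} {m i : ℕ} (hi : i < m) {η : ZMod 2}
    {l : List E} (hl : ∀ x ∈ l, h i x = η) : cobd (theta h m) l = 0 := by
  induction m generalizing l with
  | zero => omega
  | succ m ih =>
    rcases l with _ | ⟨x, l⟩
    · simp
    · rw [theta_succ, cobd_cup, cobd_cobd, mul_zero, zero_add]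
      rcases (Nat.lt_succ_iff.1 hi).eq_or_lt with rfl | hlt
      · rw [cup_const (cobd_nil _) fun y hy => hl y (by simp [hy]), hl x (by simp),
          CharTwo.add_self_eq_zero]
      · have := ih hlt (l := l) fun y hy => hl y (by simp [hy])
        rw [cup_eq_zero this, this, mul_zero, add_zero]

end OffDiagonal

section Homogeneous
variable {E : Type*}

/-- Cochains supported on sequences of length `r - m`. -/
def homog (E : Type*) (r m : ℕ) : Submodule (ZMod 2) (List E → ZMod 2) where
  carrier := {φ | ∀ l, l.length + m ≠ r → φ l = 0}
  zero_mem' := fun _ _ => rfl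
  add_mem' := fun ha hb l hl => by rw [Pi.add_apply, ha l hl, hb l hl, add_zero]
  smul_mem' := fun c φ hφ l hl => by rw [Pi.smul_apply, hφ l hl, smul_zero]

/-- The homogeneous part of a cochain. -/
def part (r m : ℕ) (φ : List E → ZMod 2) : List E → ZMod 2 :=
  fun l => if l.length + m = r then φ l else 0

lemma part_mem_homog (r m : ℕ) (φ : List E → ZMod 2) : part r m φ ∈ homog E r m :=
  fun _ hl => if_neg hl

lemma part_eq_self {r m : ℕ} {φ : List E → ZMod 2} (h : φ ∈ homog E r m) : part r m φ = φ := by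
  funext l
  rw [part]
  split_ifs with hl
  · rfl
  · exact (h l hl).symm

lemma cobd_part (r m : ℕ) (φ : List E → ZMod 2) : cobd (part r (m + 1) φ) = part r m (cobd φ) := by
  funext l
  induction l generalizing φ m with
  | nil => simp [part]
  | cons x l ih =>
    have h1 : (fun m' => part r (m + 1) φ (x :: m')) =
        part r (m + 2) fun m' => φ (x :: m') := by
      funext m'
      simp only [part, List.length_cons]
      congr 1
      exact propext ⟨fun h => by omega, fun h => by omega⟩
    rw [cobd_cons, h1, ih]
    simp only [part, List.length_cons, cobd_cons]
    by_cases h : l.length + 1 + m = r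
    · rw [if_pos (by omega), if_pos (by omega), if_pos h]
    · rw [if_neg (by omega), if_neg (by omega), if_neg h, add_zero]

lemma cobd_mem_homog {r m : ℕ} {φ : List E → ZMod 2} (h : φ ∈ homog E r (m + 1)) :
    cobd φ ∈ homog E r m := by
  rw [← part_eq_self h, cobd_part]
  exact part_mem_homog r m _

lemma theta_mem_homog (h : ℕ → E → ZMod 2) {r m : ℕ} (hm : m ≤ r) :
    theta h (r - m) ∈ homog E r m := by
  obtain ⟨n, rfl⟩ := Nat.exists_eq_add_of_le hm
  rw [Nat.add_sub_cancel_left]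
  clear hm
  induction n generalizing m with
  | zero =>
    intro l hl
    rcases l with _ | ⟨x, l⟩
    · simp at hl
    · simp [theta]
  | succ n ih =>
    have := cobd_mem_homog (ih (m := m + 1))
    intro l hl
    exact cup_eq_zero (this l (by omega))

lemma theta_map {F : Type*} (h : ℕ → F → ZMod 2) (f : E → F) (m : ℕ) (l : List E) :
    theta (fun i x => h i (f x)) m l = theta h m (l.map f) := by
  induction m generalizing l with
  | zero => simp [theta]
  | succ m ih =>
    rcases l with _ | ⟨x, l⟩
    · rfl
    · have : theta (fun i x => h i (f x)) m = fun l => theta h m (l.map f) := funext ih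
      rw [theta_succ, theta_succ, cup_cons, List.map_cons, cup_cons, ← List.map_cons, ← cobd_map,
        this]

/-- Pullback of cochains. -/
def pullback (f : E → E) : (List E → ZMod 2) →ₗ[ZMod 2] (List E → ZMod 2) :=
  LinearMap.funLeft (ZMod 2) (ZMod 2) (List.map f)

lemma pullback_apply (f : E → E) (φ : List E → ZMod 2) (l : List E) :
    pullback f φ l = φ (l.map f) := rfl

lemma cobd_pullback (f : E → E) (φ : List E → ZMod 2) :
    cobd (pullback f φ) = pullback f (cobd φ) :=
  funext fun l => cobd_map f φ l

lemma pullback_mem_homog (f : E → E) {r m : ℕ} {φ : List E → ZMod 2} (h : φ ∈ homog E r m) :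
    pullback f φ ∈ homog E r m :=
  fun l hl => h _ (by simpa using hl)

lemma theta_add_pullback_swap {M : Type*} {h : ℕ → M × M → ZMod 2}
    (hh : ∀ i p, p.1 ≠ p.2 → h i p + h i p.swap = 1) (m : ℕ) {l : List (M × M)}
    (hl : ∀ p ∈ l, p.1 ≠ p.2) :
    theta h (m + 1) l + theta h (m + 1) (l.map Prod.swap) = cobd (theta h m) l := by
  suffices hs : ∀ l : List (M × M), (∀ p ∈ l, p.1 ≠ p.2) →
      cobd (theta h m) (l.map Prod.swap) = cobd (theta h m) l by
    rcases l with _ | ⟨x, l⟩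
    · simp [theta_succ]
    · have := hs _ hl
      rw [List.map_cons] at this
      rw [theta_succ, List.map_cons, cup_cons, cup_cons, this, ← add_mul, hh _ _ (hl x (by simp)),
        one_mul]
  clear hl l
  induction m with
  | zero =>
    intro l _
    rw [← cobd_map]
    simp [theta]
  | succ m ih =>
    intro l hl
    have : cobd (theta h (m + 1) + (fun l => theta h (m + 1) (l.map Prod.swap)) +
        cobd (theta h m)) l = 0 := by
      refine cobd_eq_zero_of_sublist fun l' hl' _ => ?_
      have hl' : ∀ p ∈ l', p.1 ≠ p.2 := fun p hp => hl p (hl'.subset hp)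
      rw [Pi.add_apply, Pi.add_apply]
      rcases l' with _ | ⟨x, l'⟩
      · simp [theta_succ]
      · have := ih _ hl'
        rw [List.map_cons] at this
        rw [theta_succ, List.map_cons, cup_cons, cup_cons, this, ← add_mul,
          hh _ _ (hl' x (by simp)), one_mul, CharTwo.add_self_eq_zero]
    rw [cobd_add, cobd_add, cobd_cobd, add_zero, cobd_map] at this
    exact (CharTwo.add_eq_zero.1 this).symm

end Homogeneous

section Null
variable {M : Type*} [TopologicalSpace M]

/-- The augmented cochains whose germ on the complement of the diagonal near `(y, y)` vanishes
locally. -/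
def nullCochains (y : M) : Submodule (ZMod 2) (List (M × M) → ZMod 2) where
  carrier := {φ | φ [] = 0 ∧
    ∀ᶠ p in 𝓝 (y, y), p.1 ≠ p.2 → ∀ n, ∀ᶠ l in nearDiag n p, φ l = 0}
  zero_mem' := ⟨rfl, .of_forall fun _ _ _ => .of_forall fun _ => rfl⟩
  add_mem' := by
    rintro a b ⟨ha0, ha⟩ ⟨hb0, hb⟩
    refine ⟨by rw [Pi.add_apply, ha0, hb0, add_zero], ?_⟩
    filter_upwards [ha, hb] with p h1 h2 hp n
    filter_upwards [h1 hp n, h2 hp n] with l h1 h2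
    rw [Pi.add_apply, h1, h2, add_zero]
  smul_mem' := by
    rintro c a ⟨ha0, ha⟩
    refine ⟨by rw [Pi.smul_apply, ha0, smul_zero], ?_⟩
    filter_upwards [ha] with p h1 hp n
    filter_upwards [h1 hp n] with l h1
    rw [Pi.smul_apply, h1, smul_zero]

lemma cobd_mem_nullCochains {y : M} {φ : List (M × M) → ZMod 2} (h : φ ∈ nullCochains y) :
    cobd φ ∈ nullCochains y := by
  refine ⟨cobd_nil φ, ?_⟩
  filter_upwards [h.2] with p h1 hp n
  exact nearDiag_mono (Nat.le_succ n) p (eventually_cobd_eq_zero (h1 hp n))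

lemma pullback_mem_nullCochains {y : M} {f : M × M → M × M} (hf : Continuous f)
    (hy : f (y, y) = (y, y)) (hne : ∀ p, p.1 ≠ p.2 → (f p).1 ≠ (f p).2)
    {φ : List (M × M) → ZMod 2} (h : φ ∈ nullCochains y) : pullback f φ ∈ nullCochains y := by
  refine ⟨h.1, ?_⟩
  have := hf.tendsto (y, y)
  rw [hy] at this
  filter_upwards [this.eventually h.2] with p h1 hp n
  exact (tendsto_map_nearDiag hf.continuousAt n).eventually (h1 (hne p hp) n)

/-- Vanishing germs vanish at nearby points of the diagonal. -/
lemma eventually_mem_nullCochains {x : M} {φ : List (M × M) → ZMod 2}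
    (h : φ ∈ nullCochains x) : ∀ᶠ y in 𝓝 x, φ ∈ nullCochains y := by
  have hc : Tendsto (fun y : M => (y, y)) (𝓝 x) (𝓝 (x, x)) :=
    (continuous_id.prodMk continuous_id).tendsto x
  filter_upwards [hc.eventually (eventually_eventually_nhds.2 h.2)] with y hy
  exact ⟨h.1, hy⟩

/-- A cochain vanishing on the sequences with entries off the diagonal near `(y, y)` is null. -/
lemma mem_nullCochains_of_forall [T2Space M] {y : M} {φ : List (M × M) → ZMod 2}
    {P : M × M → Prop} (hP : ∀ᶠ p in 𝓝 (y, y), P p)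
    (h : ∀ l : List (M × M), (∀ p ∈ l, P p ∧ p.1 ≠ p.2) → φ l = 0) : φ ∈ nullCochains y := by
  refine ⟨h [] (by simp), ?_⟩
  have hopen : IsOpen {p : M × M | p.1 ≠ p.2} :=
    (isClosed_eq continuous_fst continuous_snd).isOpen_compl
  filter_upwards [eventually_eventually_nhds.2 hP] with p hp hne n
  filter_upwards [eventually_forall_mem (hp.and (hopen.mem_nhds hne)) n] with l hl
  exact h l hl

end Null

section Chart
variable {M : Type*} {r : ℕ}

open scoped Classical in
/-- The comparison of the `i`-th coordinates of two points, ties being broken by a well-order. -/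
noncomputable def coordLT (e : M → EuclideanSpace ℝ (Fin r)) (i : ℕ) (p : M × M) : ZMod 2 :=
  if ∃ j : Fin r, (j : ℕ) = i ∧ e p.1 j < e p.2 j then 1
  else if ∃ j : Fin r, (j : ℕ) = i ∧ e p.2 j < e p.1 j then 0
  else if WellOrderingRel p.1 p.2 then 1 else 0

lemma coordLT_of_lt {e : M → EuclideanSpace ℝ (Fin r)} {i : Fin r} {p : M × M}
    (h : e p.1 i < e p.2 i) : coordLT e i p = 1 :=
  if_pos ⟨i, rfl, h⟩

lemma coordLT_of_gt {e : M → EuclideanSpace ℝ (Fin r)} {i : Fin r} {p : M × M}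
    (h : e p.2 i < e p.1 i) : coordLT e i p = 0 := by
  rw [coordLT, if_neg, if_pos ⟨i, rfl, h⟩]
  rintro ⟨j, hj, hlt⟩
  rw [Fin.ext hj] at hlt
  exact lt_asymm h hlt

lemma coordLT_add_swap (e : M → EuclideanSpace ℝ (Fin r)) (i : ℕ) (p : M × M)
    (hp : p.1 ≠ p.2) : coordLT e i p + coordLT e i p.swap = 1 := by
  by_cases hi : ∃ j : Fin r, (j : ℕ) = i ∧ e p.1 j ≠ e p.2 j
  · obtain ⟨j, rfl, hj⟩ := hi
    rcases lt_or_gt_of_ne hj with h | h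
    · rw [coordLT_of_lt h, coordLT_of_gt (p := p.swap) h, add_zero]
    · rw [coordLT_of_gt h, coordLT_of_lt (p := p.swap) h, zero_add]
  · push Not at hi
    have h1 : ¬ ∃ j : Fin r, (j : ℕ) = i ∧ e p.1 j < e p.2 j := by
      rintro ⟨j, hj, hlt⟩
      exact hlt.ne (hi j hj)
    have h2 : ¬ ∃ j : Fin r, (j : ℕ) = i ∧ e p.2 j < e p.1 j := by
      rintro ⟨j, hj, hlt⟩
      exact hlt.ne' (hi j hj)
    simp only [coordLT, Prod.fst_swap, Prod.snd_swap, if_neg h1, if_neg h2]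
    rcases trichotomous_of WellOrderingRel p.1 p.2 with h | h | h
    · rw [if_pos h, if_neg (asymm_of WellOrderingRel h), add_zero]
    · exact absurd h hp
    · rw [if_pos h, if_neg (asymm_of WellOrderingRel h), zero_add]

variable [TopologicalSpace M]

/-- The fundamental cochain of the complement of the diagonal, in a chart. -/
noncomputable def fundCochain (e : OpenPartialHomeomorph M (EuclideanSpace ℝ (Fin r))) :
    ℕ → List (M × M) → ZMod 2 :=
  fun m => theta (coordLT e) (r - m)

lemma fundCochain_mem_homog (e : OpenPartialHomeomorph M (EuclideanSpace ℝ (Fin r))) {m : ℕ}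
    (hm : m ≤ r) : fundCochain e m ∈ homog (M × M) r m :=
  theta_mem_homog _ hm

lemma fundCochain_nil (e : OpenPartialHomeomorph M (EuclideanSpace ℝ (Fin r))) :
    fundCochain e r [] = 1 := by
  simp [fundCochain, theta]

lemma fundCochain_swap_mem [T2Space M]
    (e : OpenPartialHomeomorph M (EuclideanSpace ℝ (Fin r))) (y : M) {m : ℕ} (hm : m < r) : cobd (fundCochain e (m + 1)) + (fundCochain e m +
      pullback Prod.swap (fundCochain e m)) ∈ nullCochains y := by
  refine mem_nullCochains_of_forall (P := fun _ => True) (.of_forall fun _ => trivial)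
    fun l hl => ?_
  have := theta_add_pullback_swap (coordLT_add_swap e) (r - (m + 1)) fun p hp => (hl p hp).2
  rw [show r - (m + 1) + 1 = r - m by omega] at this
  rw [Pi.add_apply, Pi.add_apply, pullback_apply, fundCochain, fundCochain, this,
    CharTwo.add_self_eq_zero]

lemma cobd_fundCochain_mem {e : OpenPartialHomeomorph M (EuclideanSpace ℝ (Fin r))} {y : M}
    (hy : y ∈ e.source) : cobd (fundCochain e 0) ∈ nullCochains y := by
  refine ⟨cobd_nil _, ?_⟩
  have hs : e.source ×ˢ e.source ∈ 𝓝 (y, y) :=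
    (e.open_source.prod e.open_source).mem_nhds ⟨hy, hy⟩
  filter_upwards [hs] with p hp hne n
  have : ∃ i, e p.1 i ≠ e p.2 i := by
    by_contra! h
    exact hne (e.injOn hp.1 hp.2 (PiLp.ext h))
  obtain ⟨i, hi⟩ := this
  have hc1 : ContinuousAt (fun q : M × M => e q.1 i) p :=
    (by fun_prop : Continuous fun v : EuclideanSpace ℝ (Fin r) => v i).continuousAt.comp
      ((e.continuousAt hp.1).comp continuousAt_fst)
  have hc2 : ContinuousAt (fun q : M × M => e q.2 i) p :=
    (by fun_prop : Continuous fun v : EuclideanSpace ℝ (Fin r) => v i).continuousAt.comp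
      ((e.continuousAt hp.2).comp continuousAt_snd)
  rcases lt_or_gt_of_ne hi with h | h
  · filter_upwards [eventually_forall_mem (hc1.eventually_lt hc2 h) n] with l hl
    exact cobd_theta_eq_zero i.2 fun q hq => coordLT_of_lt (hl q hq)
  · filter_upwards [eventually_forall_mem (hc2.eventually_lt hc1 h) n] with l hl
    exact cobd_theta_eq_zero i.2 fun q hq => coordLT_of_gt (hl q hq)

/-- The germ at `(y, y)` of the reduced cohomology of the complement of the diagonal is spanned
by the class of `fundCochain`, in codegree zero. -/
theorem exists_add_cobd_mem_nullCochains
    {e : OpenPartialHomeomorph M (EuclideanSpace ℝ (Fin r))} {y : M} (hy : y ∈ e.source) {m : ℕ}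
    {φ : List (M × M) → ZMod 2} (hφ : φ ∈ homog (M × M) r m) (hd : cobd φ ∈ nullCochains y) :
    ∃ ε : ZMod 2, (m ≠ 0 → ε = 0) ∧ ∃ ψ ∈ homog (M × M) r (m + 1),
      φ + ε • fundCochain e 0 + cobd ψ ∈ nullCochains y := by
  set f : EuclideanSpace ℝ (Fin r) × EuclideanSpace ℝ (Fin r) → M × M :=
    Prod.map e.symm e.symm with hf
  have hfc : ∀ q, q.1 ∈ e.target → q.2 ∈ e.target → ContinuousAt f q := fun q h1 h2 =>
    (e.continuousAt_symm h1).prodMap (e.continuousAt_symm h2)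
  have hty : e y ∈ e.target := e.map_source hy
  have hfy : f (e y, e y) = (y, y) := by simp [hf, e.left_inv hy]
  have hev : ∀ᶠ q in 𝓝 (e y, e y), (f q).1 ≠ (f q).2 →
      ∀ n, ∀ᶠ l in nearDiag n (f q), cobd φ l = 0 := by
    have := (hfc (e y, e y) hty hty).tendsto
    rw [hfy] at this
    exact this.eventually hd.2
  rw [nhds_prod_eq, (Metric.nhds_basis_ball.prod_self).eventually_iff] at hev
  obtain ⟨δ, hδ, hball⟩ := hev
  obtain ⟨δ', hδ', htarget⟩ := Metric.isOpen_iff.1 e.open_target _ hty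
  set B := Metric.ball (e y) (min δ δ') with hBdef
  have hBt : B ⊆ e.target := (Metric.ball_subset_ball (min_le_right _ _)).trans htarget
  obtain ⟨ε, ψ, hnil, hψ⟩ := exists_eq_theta_add_cobd (B := B) Metric.isOpen_ball
    (convex_ball _ _) (Metric.nonempty_ball.2 (by positivity))
    (h := fun i q => coordLT e i (f q)) (m := r) (N := r) (φ := fun l => φ (l.map f))
    (fun i q h1 h2 hlt => coordLT_of_lt (by
      simpa [hf, e.right_inv (hBt h1), e.right_inv (hBt h2)] using hlt))
    (fun i q h1 h2 hlt => coordLT_of_gt (by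
      simpa [hf, e.right_inv (hBt h1), e.right_inv (hBt h2)] using hlt)) le_rfl
    (fun q hq => by
      obtain ⟨h1, h2, i, -, hi⟩ := hq
      have hne : (f q).1 ≠ (f q).2 := fun h =>
        hi (congrArg (fun v => v i) (e.symm.injOn (hBt h1) (hBt h2) h))
      have hqB : q ∈ Metric.ball (e y) δ ×ˢ Metric.ball (e y) δ :=
        ⟨Metric.ball_subset_ball (min_le_left _ _) h1,
          Metric.ball_subset_ball (min_le_left _ _) h2⟩
      filter_upwards [(tendsto_map_nearDiag (hfc q (hBt h1) (hBt h2)) (r + 2 * r)).eventually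
        (hball hqB hne (r + 2 * r))] with l hl
      rw [cobd_map, hl])
  set g : M × M → EuclideanSpace ℝ (Fin r) × EuclideanSpace ℝ (Fin r) := Prod.map e e with hg
  refine ⟨if m = 0 then ε else 0, fun h => if_neg h,
    part r (m + 1) fun l => ψ (l.map g), part_mem_homog _ _ _, ?_⟩
  have key : ∀ l : List (M × M),
      (l.length ≤ r → φ l + ε * fundCochain e 0 l + cobd ψ (l.map g) = 0) →
      (φ + (if m = 0 then ε else 0) • fundCochain e 0 +
        cobd (part r (m + 1) fun l => ψ (l.map g))) l = 0 := by
    intro l hl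
    rw [Pi.add_apply, Pi.add_apply, Pi.smul_apply, smul_eq_mul, cobd_part, part]
    by_cases hlen : l.length + m = r
    · rw [if_pos hlen, cobd_map]
      split_ifs with h0
      · exact hl (by omega)
      · have := hl (by omega)
        rwa [fundCochain_mem_homog e (Nat.zero_le r) l (by omega), mul_zero, add_zero,
          ← zero_mul (fundCochain e 0 l), ← zero_mul (fundCochain e 0 l)] at this ⊢
    · rw [if_neg hlen, hφ l hlen, add_zero, zero_add]
      split_ifs with h0
      · rw [fundCochain_mem_homog e (Nat.zero_le r) l (by omega), mul_zero]
      · rw [zero_mul]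
  refine ⟨key [] fun _ => ?_, ?_⟩
  · have hnil : φ [] = ε * fundCochain e 0 [] := by
      rw [theta_map] at hnil
      exact hnil
    rw [hnil, List.map_nil, cobd_nil, add_zero, CharTwo.add_self_eq_zero]
  · have hW : ∀ᶠ x in 𝓝 y, x ∈ e.source ∧ e x ∈ B :=
      (e.open_source.eventually_mem hy).and ((e.continuousAt hy).eventually
        (Metric.ball_mem_nhds _ (by positivity)))
    filter_upwards [hW.prod_nhds hW] with p hp hne n
    have hgp : g p ∈ offDiag B r := by
      refine ⟨hp.1.2, hp.2.2, ?_⟩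
      by_contra! h
      exact hne (e.injOn hp.1.1 hp.2.1 (PiLp.ext fun i => h i i.2))
    have hgc : ContinuousAt g p := (e.continuousAt hp.1.1).prodMap (e.continuousAt hp.2.1)
    have hs : ∀ᶠ q in 𝓝 p, q ∈ e.source ×ˢ e.source :=
      (e.open_source.prod e.open_source).mem_nhds ⟨hp.1.1, hp.2.1⟩
    have hr : ∀ᶠ l in nearDiag n p, l.length ≤ r →
        φ l + ε * fundCochain e 0 l + cobd ψ (l.map g) = 0 := by
      obtain ⟨U, hU, H⟩ := eventually_nearDiag.1
        ((tendsto_map_nearDiag hgc r).eventually (hψ _ hgp))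
      refine eventually_nearDiag.2 ⟨_, inter_mem hU hs, fun l _ hx hlen => ?_⟩
      have := H l hlen fun x hxl => (hx x hxl).1
      have hid : (l.map g).map f = l := by
        rw [List.map_map]
        conv_rhs => rw [← List.map_id l]
        refine List.map_congr_left fun q hq => ?_
        have := (hx q hq).2
        exact Prod.ext (e.left_inv this.1) (e.left_inv this.2)
      rw [theta_map, hid] at this
      exact this
    filter_upwards [hr] with l hl
    exact key l hl

end Chart

section Zigzag
variable {Q : Type*} [AddCommGroup Q] [Module (ZMod 2) Q]

/-- The graded pieces `H m`, on which `d` lowers the index, form a complex which is exact in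
positive index. -/
structure IsAlmostExact (d : Q →ₗ[ZMod 2] Q) (H : ℕ → Submodule (ZMod 2) Q) : Prop where
  d_d : ∀ x, d (d x) = 0
  d_mem : ∀ {m x}, x ∈ H (m + 1) → d x ∈ H m
  exact : ∀ {m x}, x ∈ H (m + 1) → d x = 0 → ∃ y ∈ H (m + 2), d y = x

variable {d : Q →ₗ[ZMod 2] Q} {H : ℕ → Submodule (ZMod 2) Q}

/-- A zigzag for an involution starting at a coboundary has trivial end value. -/
lemma eval_zigzag_eq_zero (hdH : IsAlmostExact d H) {τ : Q →ₗ[ZMod 2] Q}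
    (hτ : ∀ x, τ (τ x) = x) (hτd : ∀ x, d (τ x) = τ (d x)) (hτH : ∀ m, ∀ x ∈ H m, τ x ∈ H m)
    {ev : Q →ₗ[ZMod 2] ZMod 2} (hevd : ∀ x, ev (d x) = 0) (hevτ : ∀ x, ev (τ x) = ev x)
    {r : ℕ} {w : ℕ → Q} (hw : ∀ n ≤ r, w n ∈ H n) (hdw : ∀ n < r, d (w (n + 1)) = w n + τ (w n))
    (hw0 : ∃ y ∈ H 1, d y = w 0) : ev (w r) = 0 := by
  have key : ∀ n ≤ r, ∃ y ∈ H (n + 1), ∃ z, w n = d y + (z + τ z) := by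
    intro n
    induction n with
    | zero =>
      intro _
      obtain ⟨y, hy, h⟩ := hw0
      exact ⟨y, hy, 0, by simp [h]⟩
    | succ n ih =>
      intro hn
      obtain ⟨y, hy, z, hz⟩ := ih (by omega)
      obtain ⟨y', hy', h'⟩ := hdH.exact (x := w (n + 1) + (y + τ y))
        (add_mem (hw _ hn) (add_mem hy (hτH _ _ hy))) (by
          have h1 := ZModModule.add_self (d y)
          have h2 := ZModModule.add_self (τ (d y))
          have h3 := ZModModule.add_self z
          have h4 := ZModModule.add_self (τ z)
          rw [map_add, hdw n (by omega), hz, map_add, map_add, map_add, hτd, hτ]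
          calc _ = (d y + d y) + (τ (d y) + τ (d y)) + (z + z) + (τ z + τ z) := by abel
            _ = 0 := by rw [h1, h2, h3, h4]; simp)
      refine ⟨y', hy', y, ?_⟩
      rw [h', add_assoc, ZModModule.add_self, add_zero]
  obtain ⟨y, -, z, h⟩ := key r le_rfl
  rw [h, map_add, map_add, hevd, hevτ, zero_add, CharTwo.add_self_eq_zero]

lemma sum_sum_eq_zero_of_symm {ι A : Type*} [Fintype ι] [DecidableEq ι] [AddCommGroup A]
    [Module (ZMod 2) A] {F : ι → ι → A} (hs : ∀ i j, F i j = F j i) (h0 : ∀ i, F i i = 0) :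
    ∑ i, ∑ j, F i j = 0 := by
  rw [← Fintype.sum_prod_type']
  refine Finset.sum_involution (fun p _ => p.swap) (fun p _ => ?_) (fun p _ hp he => hp ?_)
    (fun _ _ => Finset.mem_univ _) (fun p _ => p.swap_swap)
  · rw [Prod.fst_swap, Prod.snd_swap, hs p.2, ZModModule.add_self]
  · obtain ⟨i, j⟩ := p
    obtain rfl : j = i := congrArg Prod.fst he
    exact h0 j

lemma sum_sub_single {ι : Type*} [Fintype ι] [DecidableEq ι] {a : ι → ℕ} {i : ι} (h : a i ≠ 0) :
    ∑ j, (a - Pi.single i 1 : ι → ℕ) j + 1 = ∑ j, a j := by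
  have : a = (a - Pi.single i 1) + Pi.single i 1 := by
    rw [tsub_add_cancel_of_le]
    intro j
    rcases eq_or_ne j i with rfl | hj
    · simpa using Nat.one_le_iff_ne_zero.2 h
    · simp [hj]
  conv_rhs => rw [this]
  simp only [Pi.add_apply, Finset.sum_add_distrib]
  simp

/-- A system of zigzags for finitely many commuting involutions. -/
lemma exists_multi_zigzag (hdH : IsAlmostExact d H) {ι : Type*} [Fintype ι] [DecidableEq ι]
    {σ : ι → Q →ₗ[ZMod 2] Q} (hσ : ∀ i x, σ i (σ i x) = x)
    (hcomm : ∀ i j x, σ i (σ j x) = σ j (σ i x)) (hσd : ∀ i x, d (σ i x) = σ i (d x))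
    (hσH : ∀ i m, ∀ x ∈ H m, σ i x ∈ H m) {t : Q} (ht : t ∈ H 0) (hdt : d t = 0)
    (htσ : ∀ i, ∃ y ∈ H 1, d y = t + σ i t) (n : ℕ) :
    ∃ Θ : (ι → ℕ) → Q, Θ 0 = t ∧ (∀ a, ∑ i, a i ≤ n → Θ a ∈ H (∑ i, a i)) ∧
      ∀ a, ∑ i, a i ≤ n → d (Θ a) = ∑ i, if a i = 0 then 0 else
        Θ (a - Pi.single i 1) + σ i (Θ (a - Pi.single i 1)) := by
  induction n with
  | zero =>
    have h0 : ∀ a : ι → ℕ, ∑ i, a i ≤ 0 → a = 0 := fun a ha => by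
      funext i
      simpa using (Finset.sum_eq_zero_iff.1 (Nat.le_zero.1 ha)) i (Finset.mem_univ i)
    refine ⟨fun _ => t, rfl, fun a ha => ?_, fun a ha => ?_⟩
    · rw [h0 a ha]
      simpa using ht
    · rw [h0 a ha]
      simp [hdt]
  | succ n ih =>
    obtain ⟨Θ, hΘ0, hΘH, hΘd⟩ := ih
    let R : (ι → ℕ) → Q := fun a => ∑ i, if a i = 0 then 0 else
      Θ (a - Pi.single i 1) + σ i (Θ (a - Pi.single i 1))
    have hR : ∀ a, ∑ i, a i = n + 1 → ∃ y ∈ H (n + 1), d y = R a := by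
      intro a ha
      have hsub : ∀ i, a i ≠ 0 → ∑ j, (a - Pi.single i 1 : ι → ℕ) j = n := fun i hi => by
        have := sum_sub_single hi
        omega
      rcases n with _ | n
      · choose y hy hdy using htσ
        refine ⟨∑ i, if a i = 0 then 0 else y i, Submodule.sum_mem _ fun i _ => ?_, ?_⟩
        · split_ifs
          exacts [zero_mem _, hy i]
        · rw [map_sum]
          refine Finset.sum_congr rfl fun i _ => ?_
          split_ifs with hi
          · exact map_zero d
          · have : a - Pi.single i 1 = 0 := by
              funext j
              exact Finset.sum_eq_zero_iff.1 (hsub i hi) j (Finset.mem_univ j)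
            rw [hdy, this, hΘ0]
      · refine hdH.exact (Submodule.sum_mem _ fun i _ => ?_) ?_
        · split_ifs with hi
          · exact zero_mem _
          · have := hΘH (a - Pi.single i 1) (hsub i hi).le
            rw [hsub i hi] at this
            exact add_mem this (hσH _ _ _ this)
        · let Y : (ι → ℕ) → ι → ι → Q := fun b i j =>
            (Θ b + σ i (Θ b)) + σ j (Θ b + σ i (Θ b))
          have hY : ∀ i, d (if a i = 0 then 0 else
              Θ (a - Pi.single i 1) + σ i (Θ (a - Pi.single i 1))) =
              ∑ j, if a i ≠ 0 ∧ (a - Pi.single i 1 : ι → ℕ) j ≠ 0 then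
                Y (a - Pi.single i 1 - Pi.single j 1) i j else 0 := by
            intro i
            by_cases hi : a i = 0
            · simp [hi]
            · rw [if_neg hi, map_add, hσd, hΘd _ (hsub i hi).le, map_sum, ← Finset.sum_add_distrib]
              refine Finset.sum_congr rfl fun j _ => ?_
              by_cases hj : (a - Pi.single i 1 : ι → ℕ) j = 0
              · simp [hj]
              · rw [if_neg hj, if_pos ⟨hi, hj⟩]
                simp only [Y, map_add, hcomm j i]
                abel
          rw [map_sum, Finset.sum_congr rfl fun i _ => hY i]
          refine sum_sum_eq_zero_of_symm (fun i j => ?_) fun i => ?_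
          · rcases eq_or_ne i j with rfl | hij
            · rfl
            · have h1 : (a - Pi.single i 1 : ι → ℕ) j = a j := by simp [hij.symm]
              have h2 : (a - Pi.single j 1 : ι → ℕ) i = a i := by simp [hij]
              have h3 : ∀ b, Y b i j = Y b j i := fun b => by
                simp only [Y, map_add, hcomm j i]
                abel
              simp only [h1, h2, and_comm (a := a j ≠ 0), h3, tsub_right_comm (a := a)
                (b := Pi.single i 1)]
          · split_ifs
            · simp only [Y, map_add, hσ]
              rw [add_comm (σ i _), ZModModule.add_self]
            · rfl
    choose! y hy hdy using hR
    refine ⟨fun a => if ∑ i, a i = n + 1 then y a else Θ a, ?_, fun a ha => ?_, fun a ha => ?_⟩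
    · simp [hΘ0]
    · dsimp only
      split_ifs with h
      · rw [h]
        exact hy a h
      · exact hΘH a (by omega)
    · have hlt : ∀ i, a i ≠ 0 → ∑ j, (a - Pi.single i 1 : ι → ℕ) j ≠ n + 1 := fun i hi => by
        have := sum_sub_single hi
        omega
      have : ∑ i, (if a i = 0 then 0 else
          (if ∑ j, (a - Pi.single i 1 : ι → ℕ) j = n + 1 then y (a - Pi.single i 1)
            else Θ (a - Pi.single i 1)) +
          σ i (if ∑ j, (a - Pi.single i 1 : ι → ℕ) j = n + 1 then y (a - Pi.single i 1)
            else Θ (a - Pi.single i 1))) = R a := by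
        refine Finset.sum_congr rfl fun i _ => ?_
        split_ifs with h1 h2
        · rfl
        · exact absurd h2 (hlt i h1)
        · rfl
      dsimp only
      rw [this]
      split_ifs with h
      · exact hdy a h
      · exact hΘd a (by omega)

/-- A zigzag for a single involution. -/
lemma exists_zigzag (hdH : IsAlmostExact d H) {τ : Q →ₗ[ZMod 2] Q} (hτ : ∀ x, τ (τ x) = x)
    (hτd : ∀ x, d (τ x) = τ (d x)) (hτH : ∀ m, ∀ x ∈ H m, τ x ∈ H m) {t : Q} (ht : t ∈ H 0)
    (hdt : d t = 0) (htτ : ∃ y ∈ H 1, d y = t + τ t) (r : ℕ) :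
    ∃ u : ℕ → Q, u 0 = t ∧ (∀ n ≤ r, u n ∈ H n) ∧ ∀ n < r, d (u (n + 1)) = u n + τ (u n) := by
  obtain ⟨Θ, h0, hH, hd⟩ := exists_multi_zigzag hdH (ι := Unit) (σ := fun _ => τ) (fun _ => hτ)
    (fun _ _ _ => rfl) (fun _ => hτd) (fun _ => hτH) ht hdt (fun _ => htτ) r
  refine ⟨fun n => Θ fun _ => n, h0, fun n hn => ?_, fun n hn => ?_⟩
  · simpa using hH (fun _ => n) (by simpa using hn)
  · have h1 := hd (fun _ => n + 1) (by simpa using hn)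
    have h2 : ((fun _ => n + 1) - Pi.single () 1 : Unit → ℕ) = fun _ => n := by
      funext i
      simp
    simpa [h2] using h1

end Zigzag

section Twisted
variable {Q : Type*} [AddCommGroup Q] [Module (ZMod 2) Q] {d : Q →ₗ[ZMod 2] Q}
  {ι : Type*} [Fintype ι] [LinearOrder ι] {Γ : Type*} [CommMonoid Γ]
  {ρ : Γ →* Module.End (ZMod 2) Q}

omit [Fintype ι] in
lemma sum_twisted (σ : ι → Γ) (I : Finset ι) (x : Q) :
    ∑ i ∈ I, ρ (∏ l ∈ I with i < l, σ l) (x + ρ (σ i) x) = x + ρ (∏ l ∈ I, σ l) x := by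
  induction I using Finset.induction_on_max with
  | empty => simp [ZModModule.add_self]
  | insert m I hI ih =>
    have hm : m ∉ I := fun h => lt_irrefl m (hI m h)
    have h1 : ∀ i ∈ I, ∏ l ∈ insert m I with i < l, σ l = σ m * ∏ l ∈ I with i < l, σ l := by
      intro i hi
      rw [Finset.filter_insert, if_pos (hI i hi), Finset.prod_insert (by simp [hm])]
    have h2 : Finset.filter (m < ·) (insert m I) = ∅ := by
      refine Finset.filter_eq_empty_iff.2 fun l hl => ?_
      rcases Finset.mem_insert.1 hl with rfl | hl
      · exact lt_irrefl l
      · exact (hI l hl).not_gt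
    have h3 : ∑ i ∈ I, ρ (∏ l ∈ insert m I with i < l, σ l) (x + ρ (σ i) x) =
        ρ (σ m) (x + ρ (∏ l ∈ I, σ l) x) := by
      rw [← ih, map_sum]
      refine Finset.sum_congr rfl fun i hi => ?_
      rw [h1 i hi, map_mul, Module.End.mul_apply]
    have h4 := ZModModule.add_self (ρ (σ m) x)
    rw [Finset.sum_insert hm, h2, Finset.prod_empty, map_one, Module.End.one_apply, h3,
      Finset.prod_insert hm, map_mul, Module.End.mul_apply, map_add]
    calc _ = x + ρ (σ m) (ρ (∏ l ∈ I, σ l) x) + (ρ (σ m) x + ρ (σ m) x) := by abel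
      _ = _ := by rw [h4, add_zero]

/-- The zigzag for a product of commuting involutions extracted from a system of zigzags. -/
noncomputable def twisted (ρ : Γ →* Module.End (ZMod 2) Q) (σ : ι → Γ) (Θ : (ι → ℕ) → Q)
    (I : Finset ι) (n : ℕ) : Q :=
  ∑ a ∈ I.piAntidiag n, ρ (∏ l ∈ I, σ l ^ ∑ j ∈ I with j < l, a j) (Θ a)

omit [Fintype ι] in
lemma twisted_zero (σ : ι → Γ) (Θ : (ι → ℕ) → Q) (I : Finset ι) :
    twisted ρ σ Θ I 0 = Θ 0 := by
  simp [twisted]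

omit [LinearOrder ι] in
lemma sum_eq_of_mem_piAntidiag [DecidableEq ι] {I : Finset ι} {a : ι → ℕ} {n : ℕ}
    (ha : a ∈ I.piAntidiag n) : ∑ i, a i = n := by
  rw [Finset.mem_piAntidiag] at ha
  rw [← ha.1]
  refine (Finset.sum_subset (Finset.subset_univ I) fun i _ hi => ?_).symm
  by_contra h
  exact hi (ha.2 i h)

lemma twisted_mem {H : ℕ → Submodule (ZMod 2) Q} (hρ : ∀ γ m, ∀ x ∈ H m, ρ γ x ∈ H m)
    {σ : ι → Γ} {Θ : (ι → ℕ) → Q} {n : ℕ} (hΘ : ∀ a, ∑ i, a i = n → Θ a ∈ H (∑ i, a i))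
    (I : Finset ι) : twisted ρ σ Θ I n ∈ H n :=
  Submodule.sum_mem _ fun a ha => by
    have hs := sum_eq_of_mem_piAntidiag ha
    have := hΘ a hs
    rw [hs] at this
    exact hρ _ _ _ this

lemma map_twisted_succ (hρd : ∀ γ x, d (ρ γ x) = ρ γ (d x)) {σ : ι → Γ} {Θ : (ι → ℕ) → Q} {n : ℕ}
    (hΘ : ∀ a, ∑ i, a i = n + 1 → d (Θ a) = ∑ i, if a i = 0 then 0 else
        Θ (a - Pi.single i 1) + ρ (σ i) (Θ (a - Pi.single i 1))) (I : Finset ι) :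
    d (twisted ρ σ Θ I (n + 1)) = twisted ρ σ Θ I n + ρ (∏ l ∈ I, σ l) (twisted ρ σ Θ I n) := by
  let g : (ι → ℕ) → Γ := fun a => ∏ l ∈ I, σ l ^ ∑ j ∈ I with j < l, a j
  let Y : ι → (ι → ℕ) → Q := fun i b => Θ b + ρ (σ i) (Θ b)
  have hg : ∀ b, ∀ i ∈ I, g (b + Pi.single i 1) = g b * ∏ l ∈ I with i < l, σ l := by
    intro b i hi
    rw [Finset.prod_filter, ← Finset.prod_mul_distrib]
    refine Finset.prod_congr rfl fun l _ => ?_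
    simp only [Pi.add_apply, Finset.sum_add_distrib, pow_add]
    congr 1
    rw [Finset.sum_pi_single']
    by_cases h : i < l <;> simp [h, hi]
  have h1 : ∀ a ∈ I.piAntidiag (n + 1), d (ρ (g a) (Θ a)) =
      ∑ i ∈ I, if a i ≠ 0 then ρ (g a) (Y i (a - Pi.single i 1)) else 0 := by
    intro a ha
    rw [hρd, hΘ a (sum_eq_of_mem_piAntidiag ha), map_sum]
    rw [← Finset.sum_subset (Finset.subset_univ I)]
    · refine Finset.sum_congr rfl fun i _ => ?_
      by_cases hai : a i = 0
      · simp [hai]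
      · rw [if_neg hai, if_pos hai]
    · intro i _ hi
      have : a i = 0 := by
        by_contra h
        exact hi ((Finset.mem_piAntidiag.1 ha).2 i h)
      rw [if_pos this, map_zero]
  have h2 : ∀ i ∈ I, (∑ a ∈ I.piAntidiag (n + 1),
      if a i ≠ 0 then ρ (g a) (Y i (a - Pi.single i 1)) else 0) =
      ∑ b ∈ I.piAntidiag n, ρ (g b * ∏ l ∈ I with i < l, σ l) (Y i b) := by
    intro i hi
    have hcancel : ∀ a : ι → ℕ, a i ≠ 0 → a - Pi.single i 1 + Pi.single i 1 = a := by
      intro a ha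
      rw [tsub_add_cancel_of_le]
      intro j
      rcases eq_or_ne j i with rfl | hj
      · simpa using Nat.one_le_iff_ne_zero.2 ha
      · simp [hj]
    rw [← Finset.sum_filter]
    refine Finset.sum_nbij' (fun a => a - Pi.single i 1) (fun b => b + Pi.single i 1)
      (fun a ha => ?_) (fun b hb => ?_) (fun a ha => ?_) (fun b _ => ?_) (fun a ha => ?_)
    · obtain ⟨ha, hai⟩ := Finset.mem_filter.1 ha
      have hs := Finset.mem_piAntidiag.1 ha
      refine Finset.mem_piAntidiag.2 ⟨?_, fun j hj => hs.2 j fun h => hj (by simp [h])⟩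
      have := hs.1
      rw [← hcancel a hai] at this
      simp only [Pi.add_apply, Finset.sum_add_distrib, Finset.sum_pi_single', if_pos hi] at this
      exact Nat.succ.inj this
    · have hs := Finset.mem_piAntidiag.1 hb
      refine Finset.mem_filter.2 ⟨Finset.mem_piAntidiag.2 ⟨?_, fun j hj => ?_⟩, by simp⟩
      · simp only [Pi.add_apply, Finset.sum_add_distrib, Finset.sum_pi_single', if_pos hi, hs.1]
      · rcases eq_or_ne j i with rfl | hji
        · exact hi
        · exact hs.2 j (by simpa [hji] using hj)
    · exact hcancel a (Finset.mem_filter.1 ha).2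
    · exact add_tsub_cancel_right _ _
    · rw [← hg _ i hi, hcancel a (Finset.mem_filter.1 ha).2]
  rw [twisted, map_sum, Finset.sum_congr rfl h1, Finset.sum_comm, Finset.sum_congr rfl h2,
    Finset.sum_comm, twisted, map_sum, ← Finset.sum_add_distrib]
  refine Finset.sum_congr rfl fun b _ => ?_
  have h3 := congrArg (ρ (g b)) (sum_twisted (ρ := ρ) σ I (Θ b))
  rw [map_sum, map_add, ← Module.End.mul_apply (ρ (g b)) (ρ _) (Θ b), ← map_mul, mul_comm, map_mul,
    Module.End.mul_apply] at h3
  rw [← h3]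
  refine Finset.sum_congr rfl fun i _ => ?_
  rw [map_mul, Module.End.mul_apply]

end Twisted

lemma sum_sum_piAntidiag_eq_zero {k r : ℕ} (hr : r < k) (f : (Fin (k + 1) → ℕ) → ZMod 2) :
    ∑ I : Finset (Fin (k + 1)) with 0 ∈ I, ∑ a ∈ I.piAntidiag r, f a = 0 := by
  have h1 : ∀ I : Finset (Fin (k + 1)), ∑ a ∈ I.piAntidiag r, f a =
      ∑ a ∈ Finset.univ.piAntidiag r, if ∀ i, a i ≠ 0 → i ∈ I then f a else 0 := by
    intro I
    rw [← Finset.sum_filter]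
    refine Finset.sum_congr ?_ fun _ _ => rfl
    ext a
    simp only [Finset.mem_piAntidiag, Finset.mem_filter, Finset.mem_univ, implies_true, and_true]
    refine and_congr_left fun h => ?_
    rw [Finset.sum_subset (Finset.subset_univ I) fun i _ hi => ?_]
    by_contra h'
    exact hi (h i h')
  rw [Finset.sum_congr rfl fun I _ => h1 I, Finset.sum_comm]
  refine Finset.sum_eq_zero fun a ha => ?_
  have : ∃ j : Fin (k + 1), j ≠ 0 ∧ a j = 0 := by
    by_contra! h
    have h2 : ∑ i : Fin k, 1 ≤ ∑ i : Fin k, a i.succ :=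
      Finset.sum_le_sum fun i _ => Nat.one_le_iff_ne_zero.2 (h _ (Fin.succ_ne_zero i))
    have h3 := (Finset.mem_piAntidiag.1 ha).1
    rw [Fin.sum_univ_succ] at h3
    simp at h2
    omega
  obtain ⟨j, hj0, hj⟩ := this
  have hmem : ∀ (I : Finset (Fin (k + 1))) i, i ≠ j → (i ∈ symmDiff I {j} ↔ i ∈ I) := by
    intro I i hi
    simp [Finset.mem_symmDiff, hi]
  refine Finset.sum_involution (fun I _ => symmDiff I {j}) (fun I _ => ?_) (fun I _ _ he => ?_)
    (fun I hI => ?_) (fun I _ => symmDiff_symmDiff_cancel_right _ _)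
  · have : (∀ i, a i ≠ 0 → i ∈ symmDiff I {j}) ↔ ∀ i, a i ≠ 0 → i ∈ I :=
      forall_congr' fun i => imp_congr_right fun hi => hmem I i fun h => hi (h ▸ hj)
    simp only [this, CharTwo.add_self_eq_zero]
  · exact Finset.singleton_ne_empty j (symmDiff_eq_left.1 he)
  · simpa [hmem I 0 hj0.symm] using hI

section Germs
variable {M : Type*} [TopologicalSpace M]

/-- Germs at `(y, y)` of augmented cochains on the complement of the diagonal. -/
abbrev Germ (y : M) : Type _ := (List (M × M) → ZMod 2) ⧸ nullCochains y

/-- The germ of a cochain. -/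
abbrev germ (y : M) : (List (M × M) → ZMod 2) →ₗ[ZMod 2] Germ y := (nullCochains y).mkQ

/-- The coboundary on germs. -/
def germCobd (y : M) : Germ y →ₗ[ZMod 2] Germ y :=
  (nullCochains y).mapQ _ cobdₗ fun _ h => cobd_mem_nullCochains h

/-- The homogeneous germs. -/
def germHomog (r : ℕ) (y : M) (m : ℕ) : Submodule (ZMod 2) (Germ y) :=
  (homog (M × M) r m).map (germ y)

/-- The value of a germ at the empty sequence. -/
def germEval (y : M) : Germ y →ₗ[ZMod 2] ZMod 2 :=
  (nullCochains y).liftQ (LinearMap.proj []) fun _ h => h.1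

/-- The self-maps inducing maps of germs at `(y, y)`. -/
structure IsAdmissible (y : M) (f : M × M → M × M) : Prop where
  continuous : Continuous f
  map_self : f (y, y) = (y, y)
  map_ne : ∀ p, p.1 ≠ p.2 → (f p).1 ≠ (f p).2

/-- The pullback of germs. -/
def germPullback {y : M} {f : M × M → M × M} (hf : IsAdmissible y f) : Germ y →ₗ[ZMod 2] Germ y :=
  (nullCochains y).mapQ _ (pullback f) fun _ h =>
    pullback_mem_nullCochains hf.continuous hf.map_self hf.map_ne h

variable {y : M} {r : ℕ}

lemma germ_eq_iff {φ ψ : List (M × M) → ZMod 2} :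
    germ y φ = germ y ψ ↔ φ + ψ ∈ nullCochains y := by
  rw [← ZModModule.sub_eq_add, ← Submodule.Quotient.eq]
  rfl

lemma germEval_germ (φ : List (M × M) → ZMod 2) : germEval y (germ y φ) = φ [] := rfl

lemma germEval_germCobd (x : Germ y) : germEval y (germCobd y x) = 0 := by
  obtain ⟨φ, rfl⟩ := Submodule.mkQ_surjective _ x
  exact cobd_nil φ

lemma germEval_germPullback {f : M × M → M × M} (hf : IsAdmissible y f) (x : Germ y) :
    germEval y (germPullback hf x) = germEval y x := by
  obtain ⟨φ, rfl⟩ := Submodule.mkQ_surjective _ x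
  rfl

lemma germCobd_germPullback {f : M × M → M × M} (hf : IsAdmissible y f) (x : Germ y) :
    germCobd y (germPullback hf x) = germPullback hf (germCobd y x) := by
  obtain ⟨φ, rfl⟩ := Submodule.mkQ_surjective _ x
  exact congrArg (germ y) (cobd_pullback f φ)

lemma germPullback_mem {f : M × M → M × M} (hf : IsAdmissible y f) (m : ℕ) :
    ∀ x ∈ germHomog r y m, germPullback hf x ∈ germHomog r y m := by
  rintro _ ⟨φ, hφ, rfl⟩
  exact ⟨_, pullback_mem_homog f hφ, rfl⟩

lemma germPullback_germPullback {f : M × M → M × M} (hf : IsAdmissible y f)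
    (hff : ∀ p, f (f p) = p) (x : Germ y) : germPullback hf (germPullback hf x) = x := by
  obtain ⟨φ, rfl⟩ := Submodule.mkQ_surjective _ x
  refine congrArg (germ y) (funext fun l => ?_)
  rw [pullback_apply, pullback_apply, List.map_map, (funext hff : f ∘ f = id), List.map_id]

/-- Maps agreeing near `(y, y)` induce the same map of germs. -/
lemma germPullback_congr [T2Space M] {f g : M × M → M × M} (hf : IsAdmissible y f)
    (hg : IsAdmissible y g) (h : ∀ᶠ p in 𝓝 (y, y), f p = g p) (x : Germ y) :
    germPullback hf x = germPullback hg x := by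
  obtain ⟨φ, rfl⟩ := Submodule.mkQ_surjective _ x
  refine germ_eq_iff.2 (mem_nullCochains_of_forall h fun l hl => ?_)
  rw [Pi.add_apply, pullback_apply, pullback_apply,
    List.map_congr_left fun p hp => (hl p hp).1, CharTwo.add_self_eq_zero]

lemma isAdmissible_swap : IsAdmissible y (Prod.swap : M × M → M × M) :=
  ⟨continuous_swap, rfl, fun _ h => h.symm⟩

/-- Evaluation at fixed points close to the diagonal. -/
lemma germEval_eq_zero {f : M × M → M × M} (hf : IsAdmissible y f)
    (hfix : ∃ᶠ p in 𝓝 (y, y), p.1 ≠ p.2 ∧ f p = p) {u v : Germ y}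
    (h : germCobd y u = v + germPullback hf v) : germEval y u = 0 := by
  obtain ⟨u, rfl⟩ := Submodule.mkQ_surjective _ u
  obtain ⟨v, rfl⟩ := Submodule.mkQ_surjective _ v
  have h' : cobd u + (v + pullback f v) ∈ nullCochains y := germ_eq_iff.1 h
  obtain ⟨p, ⟨hne, hp⟩, h2⟩ := (hfix.and_eventually h'.2).exists
  obtain ⟨U, hU, hl⟩ := eventually_nearDiag.1 (h2 hne 1)
  have h3 := hl [p] le_rfl fun q hq => by
    rw [List.mem_singleton.1 hq]
    exact mem_of_mem_nhds hU
  rw [Pi.add_apply, Pi.add_apply, pullback_apply, List.map_singleton, hp,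
    CharTwo.add_self_eq_zero, add_zero, cobd_cons, cobd_nil, add_zero] at h3
  exact h3

variable {e : OpenPartialHomeomorph M (EuclideanSpace ℝ (Fin r))}

lemma isAlmostExact_germ (hy : y ∈ e.source) : IsAlmostExact (germCobd y) (germHomog r y) where
  d_d x := by
    obtain ⟨φ, rfl⟩ := Submodule.mkQ_surjective _ x
    exact congrArg (germ y) (funext (cobd_cobd φ))
  d_mem := by
    rintro m _ ⟨φ, hφ, rfl⟩
    exact ⟨_, cobd_mem_homog hφ, rfl⟩
  exact := by
    rintro m _ ⟨φ, hφ, rfl⟩ h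
    obtain ⟨ε, hε, ψ, hψ, h1⟩ := exists_add_cobd_mem_nullCochains hy hφ
      ((Submodule.Quotient.mk_eq_zero _).1 h)
    rw [hε (Nat.succ_ne_zero m), zero_smul, add_zero] at h1
    exact ⟨_, ⟨ψ, hψ, rfl⟩, (germ_eq_iff.2 h1).symm⟩

lemma germ_fundCochain_mem {m : ℕ} (hm : m ≤ r) : germ y (fundCochain e m) ∈ germHomog r y m :=
  ⟨_, fundCochain_mem_homog e hm, rfl⟩

lemma germCobd_fundCochain_zero (hy : y ∈ e.source) : germCobd y (germ y (fundCochain e 0)) = 0 :=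
  (Submodule.Quotient.mk_eq_zero _).2 (cobd_fundCochain_mem hy)

lemma germCobd_fundCochain_succ [T2Space M] {m : ℕ} (hm : m < r) :
    germCobd y (germ y (fundCochain e (m + 1))) = germ y (fundCochain e m) +
      germPullback isAdmissible_swap (germ y (fundCochain e m)) :=
  germ_eq_iff.2 (fundCochain_swap_mem e y hm)

/-- A zigzag for the swap starting at the fundamental germ has end value `1`. -/
lemma germEval_zigzag_swap [T2Space M] (hy : y ∈ e.source) {w : ℕ → Germ y}
    (hw : ∀ n ≤ r, w n ∈ germHomog r y n)
    (hdw : ∀ n < r, germCobd y (w (n + 1)) = w n + germPullback isAdmissible_swap (w n))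
    (hw0 : ∃ z ∈ germHomog r y 1, germCobd y z = germ y (fundCochain e 0) + w 0) :
    germEval y (w r) = 1 := by
  have := eval_zigzag_eq_zero (isAlmostExact_germ hy)
    (germPullback_germPullback isAdmissible_swap Prod.swap_swap)
    (germCobd_germPullback isAdmissible_swap) (germPullback_mem isAdmissible_swap)
    germEval_germCobd (germEval_germPullback isAdmissible_swap)
    (w := fun n => germ y (fundCochain e n) + w n)
    (fun n hn => add_mem (germ_fundCochain_mem hn) (hw n hn)) (fun n hn => by
      rw [map_add, map_add, hdw n hn, germCobd_fundCochain_succ hn]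
      abel) hw0
  rw [map_add, germEval_germ, fundCochain_nil] at this
  exact (CharTwo.add_eq_zero.1 this).symm

/-- The fundamental germ is invariant under involutions, up to coboundaries. -/
lemma exists_germCobd_eq_add_germPullback [T2Space M] (hy : y ∈ e.source) {f : M × M → M × M}
    (hf : IsAdmissible y f) (hff : ∀ p, f (f p) = p) :
    ∃ z ∈ germHomog r y 1, germCobd y z =
      germ y (fundCochain e 0) + germPullback hf (germ y (fundCochain e 0)) := by
  obtain ⟨ε, -, ψ, hψ, h⟩ := exists_add_cobd_mem_nullCochains hy (m := 0)
    (pullback_mem_homog f (fundCochain_mem_homog e (Nat.zero_le r))) (by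
      rw [cobd_pullback]
      exact pullback_mem_nullCochains hf.continuous hf.map_self hf.map_ne
        (cobd_fundCochain_mem hy))
  have hε : ε = 0 ∨ ε = 1 := by
    clear h
    revert ε
    decide
  rcases hε with rfl | rfl
  · rw [zero_smul, add_zero] at h
    have h1 : germPullback hf (germ y (fundCochain e 0)) = germCobd y (germ y ψ) :=
      germ_eq_iff.2 h
    have h2 := germPullback_germPullback hf hff (germ y (fundCochain e 0))
    rw [h1, ← germCobd_germPullback] at h2
    have h3 := germEval_zigzag_swap (w := 0) hy (fun n _ => zero_mem _) (fun n _ => by simp)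
      ⟨_, germPullback_mem hf 1 _ ⟨ψ, hψ, rfl⟩, by rw [h2, Pi.zero_apply, add_zero]⟩
    rw [Pi.zero_apply, map_zero] at h3
    exact absurd h3 zero_ne_one
  · rw [one_smul] at h
    refine ⟨germ y ψ, ⟨ψ, hψ, rfl⟩, (germ_eq_iff.2 ?_).symm⟩
    rwa [add_comm (pullback f _)] at h

end Germs

section Newman
variable {M : Type*} [TopologicalSpace M] {r : ℕ}

lemma isAdmissible_swap_map {y : M} {g : M → M} (hg : Continuous g) (hinj : Function.Injective g)
    (hy : g y = y) : IsAdmissible y fun p : M × M => (g p.2, g p.1) :=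
  ⟨by fun_prop, by simp [hy], fun p hp h => hp (hinj h).symm⟩

/-- A fixed point of `g` in the closure of the points moved by `g` is a limit of fixed points off
the diagonal of the twisted swap. -/
lemma frequently_graph {x : M} {g : M → M} (hg : Continuous g) (hgg : ∀ y, g (g y) = y)
    (hx : g x = x) (h : ∃ᶠ z in 𝓝 x, g z ≠ z) :
    ∃ᶠ p in 𝓝 (x, x), p.1 ≠ p.2 ∧ (g p.2, g p.1) = p := by
  have ht : Tendsto (fun z => (z, g z)) (𝓝 x) (𝓝 (x, x)) := by
    have := (continuous_id.prodMk hg).tendsto x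
    simpa only [id, hx] using this
  exact ht.frequently (h.mono fun z hz => ⟨hz.symm, by simp [hgg]⟩)

variable [T2Space M]

lemma eventually_eq_of_frequently {e : OpenPartialHomeomorph M (EuclideanSpace ℝ (Fin r))}
    (hr : r ≠ 0) {x : M} (hx : x ∈ e.source) {g : M → M} (hg : Continuous g)
    (hgg : ∀ y, g (g y) = y) (h : ∃ᶠ y in 𝓝 x, ∀ᶠ z in 𝓝 y, g z = z) :
    ∀ᶠ z in 𝓝 x, g z = z := by
  by_contra hne
  have hinj : Function.Injective g := Function.LeftInverse.injective hgg
  have hgx : g x = x := (isClosed_eq hg continuous_id).mem_of_frequently_of_tendsto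
    (h.mono fun y hy => hy.self_of_nhds) tendsto_id
  have hτ := isAdmissible_swap_map hg hinj hgx
  have hττ : ∀ p : M × M, (g (g p.1), g (g p.2)) = p := fun p => by simp [hgg]
  obtain ⟨u, hu0, huH, hud⟩ := exists_zigzag (isAlmostExact_germ hx)
    (germPullback_germPullback hτ hττ) (germCobd_germPullback hτ) (germPullback_mem hτ)
    (germ_fundCochain_mem (Nat.zero_le r)) (germCobd_fundCochain_zero hx)
    (exists_germCobd_eq_add_germPullback hx hτ hττ) r
  have hev : germEval x (u r) = 0 := by
    obtain ⟨n, rfl⟩ := Nat.exists_eq_succ_of_ne_zero hr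
    exact germEval_eq_zero hτ (frequently_graph hg hgg hgx (not_eventually.1 hne))
      (hud n n.lt_succ_self)
  choose! U hUH hUu using huH
  have h0 : ∀ᶠ y in 𝓝 x, fundCochain e 0 + U 0 ∈ nullCochains y :=
    eventually_mem_nullCochains (germ_eq_iff.1 (by rw [hUu 0 (Nat.zero_le r), hu0]))
  have hs : ∀ᶠ y in 𝓝 x, ∀ n < r, cobd (U (n + 1)) +
      (U n + pullback (fun p => (g p.2, g p.1)) (U n)) ∈ nullCochains y := by
    refine (Set.finite_lt_nat r).eventually_all.2 fun n hn => ?_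
    refine eventually_mem_nullCochains (germ_eq_iff.1 ?_)
    have := hud n hn
    rwa [← hUu n hn.le, ← hUu (n + 1) hn] at this
  obtain ⟨y, hgy, hye, h0, hs⟩ :=
    (h.and_eventually ((e.open_source.eventually_mem hx).and (h0.and hs))).exists
  have := germEval_zigzag_swap (e := e) hye (w := fun n => germ y (U n))
    (fun n hn => ⟨_, hUH n hn, rfl⟩) (fun n hn => ?_)
    ⟨0, zero_mem _, by rw [map_zero, germ_eq_iff.2 h0, ZModModule.add_self]⟩
  · rw [germEval_germ] at this
    rw [← hUu r le_rfl, germEval_germ, this] at hev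
    exact one_ne_zero hev
  · rw [germPullback_congr isAdmissible_swap (isAdmissible_swap_map hg hinj hgy.self_of_nhds)]
    · exact germ_eq_iff.2 (hs n hn)
    · rw [nhds_prod_eq]
      filter_upwards [hgy.prod_mk hgy] with p hp
      rw [hp.1, hp.2]
      rfl

/-- Newman's theorem for involutions. -/
theorem eq_self_of_eventually_eq [ConnectedSpace M] [ChartedSpace (EuclideanSpace ℝ (Fin r)) M]
    (hr : r ≠ 0) {g : M → M} (hg : Continuous g) (hgg : ∀ y, g (g y) = y) {x : M}
    (h : ∀ᶠ z in 𝓝 x, g z = z) (y : M) : g y = y := by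
  have hclopen : IsClopen {x : M | ∀ᶠ z in 𝓝 x, g z = z} := by
    refine ⟨isClosed_iff_frequently.2 fun x hx => ?_, isOpen_setOfPred_eventually_nhds⟩
    exact eventually_eq_of_frequently hr (mem_chart_source (EuclideanSpace ℝ (Fin r)) x) hg hgg hx
  have : y ∈ {x : M | ∀ᶠ z in 𝓝 x, g z = z} := by
    rw [hclopen.eq_univ ⟨x, h⟩]
    trivial
  exact this.self_of_nhds

end Newman

section Action
variable {M : Type*} [TopologicalSpace M] {G : Type*} [CommGroup G]

/-- The action on `M × M` generated by the diagonal action of `G` and the swap. -/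
def pairAct (φ : G →* (M ≃ₜ M)) (γ : Multiplicative (ZMod 2) × G) (p : M × M) : M × M :=
  if γ.1 = 1 then (φ γ.2 p.1, φ γ.2 p.2) else (φ γ.2 p.2, φ γ.2 p.1)

variable {φ : G →* (M ≃ₜ M)}

lemma pairAct_one (p : M × M) : pairAct φ 1 p = p := by
  simp [pairAct]

lemma pairAct_mul (γ δ : Multiplicative (ZMod 2) × G) (p : M × M) :
    pairAct φ (γ * δ) p = pairAct φ δ (pairAct φ γ p) := by
  have hcomm : ∀ (g h : G) (x : M), φ g (φ h x) = φ h (φ g x) := fun g h x => by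
    change (φ g * φ h) x = (φ h * φ g) x
    rw [← map_mul, mul_comm, map_mul]
  have h2 : ∀ a b : Multiplicative (ZMod 2), a ≠ 1 → b ≠ 1 → a * b = 1 := by decide
  obtain ⟨a, g⟩ := γ
  obtain ⟨b, h⟩ := δ
  by_cases ha : a = 1 <;> by_cases hb : b = 1 <;>
    simp only [pairAct, ha, hb, h2, Prod.mk_mul_mk, map_mul, one_mul, mul_one, if_true, if_false,
      ne_eq, not_false_eq_true] <;>
    exact Prod.ext (hcomm _ _ _) (hcomm _ _ _)

lemma isAdmissible_pairAct {x : M} (hx : ∀ g, φ g x = x) (γ : Multiplicative (ZMod 2) × G) :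
    IsAdmissible x (pairAct φ γ) where
  continuous := by
    by_cases h : γ.1 = 1
    · rw [show pairAct φ γ = fun p => (φ γ.2 p.1, φ γ.2 p.2) from funext fun p => if_pos h]
      fun_prop
    · rw [show pairAct φ γ = fun p => (φ γ.2 p.2, φ γ.2 p.1) from funext fun p => if_neg h]
      fun_prop
  map_self := by simp [pairAct, hx]
  map_ne p hp := by
    by_cases h : γ.1 = 1
    · simpa [pairAct, h] using hp
    · simpa [pairAct, h] using hp.symm

/-- The representation on germs at a fixed point. -/
def germRep {x : M} (hx : ∀ g, φ g x = x) :
    Multiplicative (ZMod 2) × G →* Module.End (ZMod 2) (Germ x) where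
  toFun γ := germPullback (isAdmissible_pairAct hx γ)
  map_one' := by
    refine LinearMap.ext fun a => ?_
    obtain ⟨a, rfl⟩ := Submodule.mkQ_surjective _ a
    refine congrArg (germ x) (funext fun l => ?_)
    rw [pullback_apply, funext pairAct_one (g := id), List.map_id]
  map_mul' γ δ := by
    refine LinearMap.ext fun a => ?_
    obtain ⟨a, rfl⟩ := Submodule.mkQ_surjective _ a
    refine congrArg (germ x) (funext fun l => ?_)
    rw [pullback_apply, pullback_apply, pullback_apply, List.map_map]
    exact congrArg a (List.map_congr_left fun p _ => pairAct_mul γ δ p)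

end Action

/-- Generators of the group acting on pairs: the swap, followed by the coordinate involutions. -/
def pairGen (k : ℕ) (l : Fin (k + 1)) :
    Multiplicative (ZMod 2) × (Fin k → Multiplicative (ZMod 2)) :=
  (if l = 0 then .ofAdd 1 else 1, fun j => if l = j.succ then .ofAdd 1 else 1)

lemma prod_pairGen_fst {k : ℕ} {I : Finset (Fin (k + 1))} (h : 0 ∈ I) :
    (∏ l ∈ I, pairGen k l).1 ≠ 1 := by
  simp [Prod.fst_prod, pairGen, h]

lemma prod_pairGen_snd {k : ℕ} {I : Finset (Fin (k + 1))} {j : Fin k} (h : j.succ ∈ I) :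
    (∏ l ∈ I, pairGen k l).2 ≠ 1 := fun h1 => by
  have := congrFun h1 j
  simp [Prod.snd_prod, pairGen, h] at this

/-- The Mann–Su bound in positive dimension. -/
theorem le_of_faithful_of_fixed {r k : ℕ} (hr : r ≠ 0) {M : Type*} [TopologicalSpace M]
    [T2Space M] [ConnectedSpace M] [ChartedSpace (EuclideanSpace ℝ (Fin r)) M]
    {φ : (Fin k → Multiplicative (ZMod 2)) →* (M ≃ₜ M)} (hinj : Function.Injective φ) {x : M}
    (hx : ∀ g, φ g x = x) : k ≤ r := by
  by_contra! hlt
  have hG : ∀ γ : Multiplicative (ZMod 2) × (Fin k → Multiplicative (ZMod 2)), γ * γ = 1 := by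
    have h : ∀ a : Multiplicative (ZMod 2), a * a = 1 := by decide
    exact fun γ => Prod.ext (h _) (funext fun i => h _)
  have hφ : ∀ g y, φ g (φ g y) = y := fun g y => by
    have := congrArg Prod.snd (hG (1, g))
    change (φ g * φ g) y = y
    rw [← map_mul, show g * g = 1 from this, map_one, homeo_one_apply]
  have he := mem_chart_source (EuclideanSpace ℝ (Fin r)) x
  set e := chartAt (EuclideanSpace ℝ (Fin r)) x
  let ρ := germRep hx
  let σ := pairGen k
  have hρρ : ∀ γ a, ρ γ (ρ γ a) = a := fun γ a => by
    rw [← Module.End.mul_apply, ← map_mul, hG, map_one, Module.End.one_apply]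
  have hρd : ∀ γ a, germCobd x (ρ γ a) = ρ γ (germCobd x a) := fun γ =>
    germCobd_germPullback (isAdmissible_pairAct hx γ)
  have hρH : ∀ γ m, ∀ a ∈ germHomog r x m, ρ γ a ∈ germHomog r x m := fun γ =>
    germPullback_mem (isAdmissible_pairAct hx γ)
  have hρev : ∀ γ a, germEval x (ρ γ a) = germEval x a := fun γ =>
    germEval_germPullback (isAdmissible_pairAct hx γ)
  obtain ⟨Θ, hΘ0, hΘH, hΘd⟩ := exists_multi_zigzag (isAlmostExact_germ he)
    (σ := fun l => ρ (σ l)) (fun l => hρρ _)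
    (fun i j a => by rw [← Module.End.mul_apply, ← map_mul, mul_comm, map_mul,
      Module.End.mul_apply]) (fun i => hρd _) (fun i => hρH _)
    (germ_fundCochain_mem (Nat.zero_le r)) (germCobd_fundCochain_zero he)
    (fun l => exists_germCobd_eq_add_germPullback he (isAdmissible_pairAct hx (σ l)) fun p => by
      rw [← pairAct_mul, hG, pairAct_one]) r
  let u := twisted ρ σ Θ
  have hud : ∀ I, ∀ n < r, germCobd x (u I (n + 1)) = u I n + ρ (∏ l ∈ I, σ l) (u I n) :=
    fun I n hn => map_twisted_succ hρd (fun a ha => hΘd a (by omega)) I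
  have hsum : ∑ I : Finset (Fin (k + 1)) with 0 ∈ I, germEval x (u I r) = 0 := by
    rw [← sum_sum_piAntidiag_eq_zero hlt fun a => germEval x (Θ a)]
    refine Finset.sum_congr rfl fun I _ => ?_
    simp only [u, twisted, map_sum, hρev]
  have hone : germEval x (u {0} r) = 1 := by
    refine germEval_zigzag_swap he
      (fun n hn => twisted_mem hρH (fun a ha => hΘH a (by omega)) {0}) (fun n hn => ?_)
      ⟨0, zero_mem _, by
        rw [map_zero, show u {0} 0 = Θ 0 from twisted_zero σ Θ {0}, hΘ0, ZModModule.add_self]⟩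
    rw [hud _ n hn]
    congr 1
    refine germPullback_congr (isAdmissible_pairAct hx _) isAdmissible_swap
      (.of_forall fun p => ?_) _
    have h2 : (∏ l ∈ ({0} : Finset (Fin (k + 1))), σ l).2 = 1 := by
      rw [Finset.prod_singleton]
      exact funext fun j => by simp [σ, pairGen, (Fin.succ_ne_zero j).symm]
    rw [pairAct, if_neg (prod_pairGen_fst (Finset.mem_singleton_self 0)), h2, map_one]
    rfl
  have hzero : ∀ I : Finset (Fin (k + 1)), 0 ∈ I → I ≠ {0} → germEval x (u I r) = 0 := by
    intro I h0 hI
    obtain ⟨l, hl, hl0⟩ : ∃ l ∈ I, l ≠ 0 := by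
      by_contra! h
      exact hI (Finset.eq_singleton_iff_unique_mem.2 ⟨h0, h⟩)
    obtain ⟨j, rfl⟩ := Fin.exists_succ_eq.2 hl0
    set g := (∏ l ∈ I, σ l).2
    have hne : ∃ᶠ z in 𝓝 x, φ g z ≠ z := by
      rw [Filter.Frequently]
      intro h
      simp only [not_not] at h
      refine prod_pairGen_snd hl (hinj (Homeomorph.ext fun y => ?_))
      rw [map_one]
      exact eq_self_of_eventually_eq hr (φ g).continuous (hφ g) h y
    have hfix := frequently_graph (φ g).continuous (hφ g) (hx g) hne
    obtain ⟨n, rfl⟩ := Nat.exists_eq_succ_of_ne_zero hr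
    refine germEval_eq_zero (isAdmissible_pairAct hx (∏ l ∈ I, σ l)) (hfix.mono fun p hp => ?_)
      (hud I n n.lt_succ_self)
    refine ⟨hp.1, ?_⟩
    rw [pairAct, if_neg (prod_pairGen_fst h0)]
    exact hp.2
  rw [Finset.sum_eq_single {0} (fun I hI => hzero I (Finset.mem_filter.1 hI).2) (by simp),
    hone] at hsum
  exact one_ne_zero hsum

lemma subsingleton_of_chartedSpace_fin_zero (M : Type*) [TopologicalSpace M] [ConnectedSpace M]
    [ChartedSpace (EuclideanSpace ℝ (Fin 0)) M] : Subsingleton M := by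
  have : DiscreteTopology M := ChartedSpace.discreteTopology (EuclideanSpace ℝ (Fin 0)) M
  exact PreconnectedSpace.trivial_of_discrete

end AlexanderSpanier

/-- Mann–Su for `p = 2`: an elementary abelian `2`-group acting faithfully with
nonempty fixed point set on a connected topological `r`-manifold has rank at most `r`. -/
theorem statement14 (r k : ℕ)
    (M : Type*) [TopologicalSpace M] [T2Space M] [SecondCountableTopology M]
    [ConnectedSpace M] [ChartedSpace (EuclideanSpace ℝ (Fin r)) M]
    (φ : (Fin k → Multiplicative (ZMod 2)) →* (M ≃ₜ M))
    (hinj : Function.Injective φ)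
    (hfix : ∃ x : M, ∀ g, φ g x = x) :
    k ≤ r := by
  obtain ⟨x, hx⟩ := hfix
  rcases eq_or_ne r 0 with rfl | hr
  · have := AlexanderSpanier.subsingleton_of_chartedSpace_fin_zero M
    by_contra! hk
    have h : (fun _ => Multiplicative.ofAdd 1 : Fin k → Multiplicative (ZMod 2)) = 1 :=
      hinj (Homeomorph.ext fun y => Subsingleton.elim _ _)
    have h' : (Multiplicative.ofAdd 1 : Multiplicative (ZMod 2)) = 1 := congrFun h ⟨0, hk⟩
    exact absurd h' (by decide)
  · exact AlexanderSpanier.le_of_faithful_of_fixed hr hinj hx
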